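/- Let (a,S) be a data pair with S flat with constants c₁, c₂ and ‖a‖ ≤ c₃, and let ρ_{a,S} be the corresponding self-consistent density of states. Then ρ_{a,S} has a uniformly Hölder-continuous, compactly supported density (also denoted ρ_{a,S}) with respect to Lebesgue measure on ℝ. Moreover there is a universal constant c > 0 such that the function (a,S,τ) ↦ ρ_{a,S}(τ), defined on 𝒜_sa × {flat S} × ℝ (with the metrics induced by ‖·‖ on 𝒜 and by the ‖·‖-operator norm on linear maps 𝒜 → 𝒜), is locally Hölder continuous with Hölder exponent c, and it is real-analytic in a neighbourhood of every point (a,S,τ) at which ρ_{a,S}(τ) > 0. -/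

import Mathlib

open MeasureTheory

noncomputable section

namespace Dyson

/-- A tracial, faithful, normal state on the C⋆-algebra `A` (our model for a finite
von Neumann algebra together with its canonical tracial state). -/
structure TracialState (A : Type*) [CStarAlgebra A] [PartialOrder A] where
  tr : A →ₗ[ℂ] ℂ
  unital : tr 1 = 1
  tracial : ∀ x y : A, tr (x * y) = tr (y * x)
  state_pos : ∀ x : A, 0 ≤ x → 0 ≤ (tr x).re ∧ (tr x).im = 0
  faithful : ∀ x : A, 0 ≤ x → tr x = 0 → x = 0
  cont : Continuous tr

/-- A positive-operator-valued measure on `ℝ`, recorded through its values on sets of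
reals together with the family of scalar measures `B ↦ ⟨x, v(B) x⟩`. -/
structure OpMeasure (A : Type*) [CStarAlgebra A] [PartialOrder A]
    (φ : TracialState A) where
  val : Set ℝ → A
  nonneg : ∀ B : Set ℝ, 0 ≤ val B
  scalar : A → Measure ℝ
  scalarFin : ∀ x : A, IsFiniteMeasure (scalar x)
  compat : ∀ (x : A) (B : Set ℝ), MeasurableSet B →
    φ.tr (star x * val B * x) = Complex.ofReal ((scalar x) B).toReal

variable {A : Type*} [CStarAlgebra A] [PartialOrder A] [StarOrderedRing A]

/-- The real part `(x + x*)/2`. -/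
def reA (x : A) : A := (2 : ℂ)⁻¹ • (x + star x)

/-- The imaginary part `(x − x*)/(2i)`. -/
def imA (x : A) : A := (2 * Complex.I)⁻¹ • (x - star x)

/-- Strictly positive (positive definite) elements, i.e. `x ≥ ε·1` for some `ε > 0`. -/
def IsPosDef (x : A) : Prop := ∃ ε : ℝ, 0 < ε ∧ Complex.ofReal ε • (1 : A) ≤ x

/-- The scalar product `⟨x, y⟩ = τ(x* y)` induced by the state. -/
def inner2 (φ : TracialState A) (x y : A) : ℂ := φ.tr (star x * y)

/-- The `L²`-norm `‖x‖₂ = ⟨x*x⟩^{1/2}` induced by the state. -/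
def nrm2 (φ : TracialState A) (x : A) : ℝ := Real.sqrt (φ.tr (star x * x)).re

/-- The `L² → L²` operator norm of a map on `A`. -/
def opNorm2 (φ : TracialState A) (f : A → A) : ℝ :=
  sInf {C : ℝ | 0 ≤ C ∧ ∀ x : A, nrm2 φ (f x) ≤ C * nrm2 φ x}

/-- `S` preserves the cone of positive semidefinite elements. -/
def PosPreserving (S : A →L[ℂ] A) : Prop := ∀ x : A, 0 ≤ x → 0 ≤ S x

/-- `S` is symmetric with respect to `⟨x, y⟩ = τ(x* y)`. -/
def SymmOp (φ : TracialState A) (S : A →L[ℂ] A) : Prop :=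
  ∀ x y : A, φ.tr (star (S x) * y) = φ.tr (star x * S y)

/-- Flatness: `c₁⟨x⟩·1 ≤ S[x] ≤ c₂⟨x⟩·1` for all positive semidefinite `x`. -/
def IsFlat (φ : TracialState A) (S : A →L[ℂ] A) (c₁ c₂ : ℝ) : Prop :=
  ∀ x : A, 0 ≤ x →
    Complex.ofReal (c₁ * (φ.tr x).re) • (1 : A) ≤ S x ∧
      S x ≤ Complex.ofReal (c₂ * (φ.tr x).re) • (1 : A)

/-- `m` solves the Dyson equation `−m(z)⁻¹ = z·1 − a + S[m(z)]` on the upper half-plane,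
with positive definite imaginary part. -/
def IsDysonSolution (a : A) (S : A →L[ℂ] A) (m : ℂ → A) : Prop :=
  ∀ z : ℂ, 0 < z.im →
    IsPosDef (imA (m z)) ∧
    m z * (z • (1 : A) - a + S (m z)) = -1 ∧
    (z • (1 : A) - a + S (m z)) * m z = -1

/-- The support of an operator-valued measure. -/
def OpMeasure.supp {φ : TracialState A} (v : OpMeasure A φ) : Set ℝ :=
  {t : ℝ | ∀ ε : ℝ, 0 < ε → v.val (Set.Ioo (t - ε) (t + ε)) ≠ 0}

/-- The self-consistent density of states `ρ = ⟨v⟩ = ⟨1, v(·) 1⟩`. -/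
def OpMeasure.dos {φ : TracialState A} (v : OpMeasure A φ) : Measure ℝ :=
  v.scalar 1

/-- `m` is the Stieltjes transform of `v`. -/
def StieltjesRep (φ : TracialState A) (v : OpMeasure A φ) (m : ℂ → A) : Prop :=
  ∀ z : ℂ, 0 < z.im → ∀ x : A,
    φ.tr (star x * m z * x) = ∫ t : ℝ, ((t : ℂ) - z)⁻¹ ∂(v.scalar x)

/-- The support of a (positive) measure on `ℝ`. -/
def measSupp (μ : Measure ℝ) : Set ℝ :=
  {t : ℝ | ∀ ε : ℝ, 0 < ε → μ (Set.Ioo (t - ε) (t + ε)) ≠ 0}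

/-- The harmonic extension `ρ(z) = ⟨Im m(z)⟩/π` of the density of states. -/
def rhoH (φ : TracialState A) (m : ℂ → A) (z : ℂ) : ℝ :=
  (φ.tr (imA (m z))).re / Real.pi

end Dyson

open Dyson in
/-- Bundles a flat data pair `(a, S)` together with the solution `m` of its Dyson
equation, its representing measure `v`, and a continuous nonnegative density `f` of the
self-consistent density of states `ρ = ⟨v⟩` with respect to Lebesgue measure. -/
def GoodData {A : Type*} [CStarAlgebra A] [PartialOrder A] [StarOrderedRing A]
    (φ : TracialState A) (c₁ c₂ c₃ : ℝ) (a : A) (S : A →L[ℂ] A)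
    (m : ℂ → A) (v : OpMeasure A φ) (f : ℝ → ℝ) : Prop :=
  IsSelfAdjoint a ∧ ‖a‖ ≤ c₃ ∧ PosPreserving S ∧ SymmOp φ S ∧
    IsFlat φ S c₁ c₂ ∧ IsDysonSolution a S m ∧
    v.val Set.univ = 1 ∧ StieltjesRep φ v m ∧
    Continuous f ∧ (∀ t : ℝ, 0 ≤ f t) ∧
    v.dos = MeasureTheory.volume.withDensity (fun t => ENNReal.ofReal (f t))

namespace Dyson

open scoped ComplexOrder
set_option linter.unusedSectionVars false

variable {A : Type*} [CStarAlgebra A] [PartialOrder A] [StarOrderedRing A]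

/-- The trace as a bundled positive linear functional. -/
def TracialState.pos (φ : TracialState A) : A →ₚ[ℂ] ℂ :=
  PositiveLinearMap.mk₀ φ.tr fun x hx => by
    have h := φ.state_pos x hx
    rw [Complex.le_def]
    exact ⟨h.1, h.2.symm⟩

lemma TracialState.tr_star (φ : TracialState A) (x : A) :
    φ.tr (star x) = star (φ.tr x) := map_star φ.pos x

lemma TracialState.tr_re_nonneg (φ : TracialState A) {x : A} (hx : 0 ≤ x) :
    0 ≤ (φ.tr x).re := (φ.state_pos x hx).1

lemma TracialState.tr_re_mono (φ : TracialState A) {x y : A} (h : x ≤ y) :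
    (φ.tr x).re ≤ (φ.tr y).re := by
  have := φ.tr_re_nonneg (sub_nonneg.2 h)
  simpa using this

lemma TracialState.tr_real_smul (φ : TracialState A) (r : ℝ) (x : A) :
    φ.tr (r • x) = r * φ.tr x := by
  rw [← Complex.coe_smul, map_smul, smul_eq_mul]

lemma TracialState.tr_real_smul_one (φ : TracialState A) (r : ℝ) :
    φ.tr (r • (1 : A)) = r := by
  rw [φ.tr_real_smul, φ.unital, mul_one]

lemma TracialState.nontrivial (φ : TracialState A) : Nontrivial A := by
  refine ⟨1, 0, fun h => ?_⟩
  have := φ.unital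
  rw [h, map_zero] at this
  exact zero_ne_one this

lemma le_norm_smul_one {x : A} (hx : IsSelfAdjoint x) : x ≤ ‖x‖ • (1 : A) := by
  rw [← Algebra.algebraMap_eq_smul_one]; exact hx.le_algebraMap_norm_self

lemma smul_one_mono {r s : ℝ} (h : r ≤ s) : r • (1 : A) ≤ s • (1 : A) :=
  smul_le_smul_of_nonneg_right h zero_le_one

lemma norm_le_of_nonneg_of_le_smul_one {x : A} {r : ℝ} (hr : 0 ≤ r) (h0 : 0 ≤ x)
    (h : x ≤ r • (1 : A)) : ‖x‖ ≤ r := by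
  rw [← Algebra.algebraMap_eq_smul_one] at h
  exact (CStarAlgebra.norm_le_iff_le_algebraMap x hr h0).2 h

lemma norm_le_of_abs_le_smul_one [Nontrivial A] {x : A} {r : ℝ} (hx : IsSelfAdjoint x)
    (h1 : -(r • (1 : A)) ≤ x) (h2 : x ≤ r • (1 : A)) : ‖x‖ ≤ r := by
  rw [← Algebra.algebraMap_eq_smul_one] at h1 h2
  rw [← map_neg] at h1
  rw [algebraMap_le_iff_le_spectrum hx] at h1
  rw [le_algebraMap_iff_spectrum_le hx] at h2
  rcases CStarAlgebra.norm_or_neg_norm_mem_spectrum hx with h | h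
  · exact h2 _ h
  · have := h1 _ h
    linarith

lemma star_mul_self_le_smul_one (x : A) : star x * x ≤ (‖x‖ ^ 2) • (1 : A) := by
  rw [← Algebra.algebraMap_eq_smul_one]; exact CStarAlgebra.star_mul_le_algebraMap_norm_sq

lemma norm_le_of_star_mul_self_le {x : A} {r : ℝ} (hr : 0 ≤ r)
    (h : star x * x ≤ (r ^ 2) • (1 : A)) : ‖x‖ ≤ r := by
  have := norm_le_of_nonneg_of_le_smul_one (sq_nonneg r) (star_mul_self_nonneg x) h
  rw [CStarRing.norm_star_mul_self, ← sq] at this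
  exact (pow_le_pow_iff_left₀ (norm_nonneg _) hr two_ne_zero).1 this

variable (φ : TracialState A)

lemma nrm2_nonneg (x : A) : 0 ≤ nrm2 φ x := Real.sqrt_nonneg _

lemma nrm2_sq (x : A) : nrm2 φ x ^ 2 = (φ.tr (star x * x)).re :=
  Real.sq_sqrt (φ.tr_re_nonneg (star_mul_self_nonneg x))

lemma nrm2_eq_preGNS (x : A) : nrm2 φ x = ‖φ.pos.toPreGNS x‖ := rfl

lemma norm_tr_star_mul_le (x y : A) : ‖φ.tr (star x * y)‖ ≤ nrm2 φ x * nrm2 φ y := by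
  have := norm_inner_le_norm (𝕜 := ℂ) (φ.pos.toPreGNS x) (φ.pos.toPreGNS y)
  exact this

lemma nrm2_add_le (x y : A) : nrm2 φ (x + y) ≤ nrm2 φ x + nrm2 φ y := by
  simp only [nrm2_eq_preGNS, map_add]
  exact norm_add_le _ _

lemma nrm2_star (x : A) : nrm2 φ (star x) = nrm2 φ x := by
  rw [nrm2, nrm2, star_star, φ.tracial]

lemma nrm2_mul_le_left (b x : A) : nrm2 φ (b * x) ≤ ‖b‖ * nrm2 φ x := by
  refine le_of_sq_le_sq ?_ (by have := nrm2_nonneg φ x; positivity)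
  rw [mul_pow, nrm2_sq, nrm2_sq]
  have h : star (b * x) * (b * x) ≤ ‖b‖ ^ 2 • (star x * x) := by
    have := star_left_conjugate_le_conjugate (star_mul_self_le_smul_one b) x
    simpa [mul_assoc] using this
  have := φ.tr_re_mono h
  rw [φ.tr_real_smul, Complex.re_ofReal_mul] at this
  exact this

lemma nrm2_mul_le_right (x b : A) : nrm2 φ (x * b) ≤ nrm2 φ x * ‖b‖ := by
  rw [← nrm2_star, star_mul, mul_comm, ← norm_star b, ← nrm2_star φ x]
  exact nrm2_mul_le_left φ _ _

lemma nrm2_one : nrm2 φ (1 : A) = 1 := by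
  rw [nrm2, star_one, one_mul, φ.unital]; simp

lemma nrm2_le_norm (x : A) : nrm2 φ x ≤ ‖x‖ := by
  simpa [nrm2_one] using nrm2_mul_le_left φ x 1

lemma norm_tr_le_nrm2 (x : A) : ‖φ.tr x‖ ≤ nrm2 φ x := by
  simpa [nrm2_one] using norm_tr_star_mul_le φ 1 x

lemma norm_tr_mul_le (x b : A) : ‖φ.tr (x * b)‖ ≤ nrm2 φ x * ‖b‖ :=
  (norm_tr_le_nrm2 φ _).trans (nrm2_mul_le_right φ x b)

lemma norm_tr_le (x : A) : ‖φ.tr x‖ ≤ ‖x‖ :=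
  (norm_tr_le_nrm2 φ x).trans (nrm2_le_norm φ x)

/-- An element whose quadratic form is bounded by `C⟨x*x⟩` is bounded by `C` in norm. -/
lemma le_smul_one_of_tr_le {h : A} (hh : IsSelfAdjoint h) {C : ℝ}
    (H : ∀ x : A, (φ.tr (star x * h * x)).re ≤ C * (φ.tr (star x * x)).re) :
    h ≤ C • (1 : A) := by
  set k : A := h - C • (1 : A) with hk
  have hks : IsSelfAdjoint k := hh.sub ((IsSelfAdjoint.all C).smul (IsSelfAdjoint.one A))
  have hp := CFC.posPart_nonneg k
  have hps : star k⁺ = k⁺ := hp.isSelfAdjoint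
  have hcube : 0 ≤ k⁺ * k⁺ * k⁺ := by
    have := star_left_conjugate_nonneg hp k⁺
    rwa [hps] at this
  have e1 : k⁺ * k * k⁺ = k⁺ * k⁺ * k⁺ := by
    have e0 : k⁺ * (k⁺ - k⁻) * k⁺ = k⁺ * k⁺ * k⁺ := by
      rw [mul_sub, sub_mul, CFC.posPart_mul_negPart]; simp
    rwa [CFC.posPart_sub_negPart k hks] at e0
  have e2 := H k⁺
  rw [hps] at e2
  have e3 : φ.tr (k⁺ * h * k⁺) = φ.tr (k⁺ * k⁺ * k⁺) + C * φ.tr (k⁺ * k⁺) := by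
    rw [← e1, ← φ.tr_real_smul, ← map_add]
    congr 1
    rw [hk]; simp [mul_sub, sub_mul]
  rw [e3] at e2
  simp only [Complex.add_re, Complex.re_ofReal_mul] at e2
  have h0 := φ.state_pos _ hcube
  have hz : k⁺ * k⁺ * k⁺ = 0 :=
    φ.faithful _ hcube (Complex.ext (by simp; linarith [h0.1]) (by simp [h0.2]))
  have hz2 : k⁺ = 0 := by
    have : star (k⁺ * k⁺) * (k⁺ * k⁺) = 0 := by
      rw [star_mul, hps, ← mul_assoc, hz, zero_mul]
    have h2 := CStarRing.star_mul_self_eq_zero_iff _ |>.1 this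
    have h3 : star k⁺ * k⁺ = 0 := by rw [hps]; exact h2
    exact CStarRing.star_mul_self_eq_zero_iff _ |>.1 h3
  have : k ≤ 0 := by
    rw [← CFC.posPart_sub_negPart k hks, hz2, zero_sub]
    exact neg_nonpos.2 (CFC.negPart_nonneg k)
  exact sub_nonpos.1 this

lemma PosPreserving.map_star {S : A →L[ℂ] A} (hS : PosPreserving S) (x : A) :
    S (star x) = star (S x) :=
  StarHomClass.map_star (PositiveLinearMap.mk₀ (S : A →ₗ[ℂ] A) hS) x

lemma PosPreserving.mono {S : A →L[ℂ] A} (hS : PosPreserving S) {x y : A} (h : x ≤ y) :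
    S x ≤ S y := by
  have := hS _ (sub_nonneg.2 h)
  rwa [map_sub, sub_nonneg] at this

lemma map_real_smul (S : A →L[ℂ] A) (r : ℝ) (x : A) : S (r • x) = r • S x := by
  rw [← Complex.coe_smul, map_smul, Complex.coe_smul]

lemma isUnit_of_one_le {x : A} (h : 1 ≤ x) : IsUnit x :=
  CStarAlgebra.isUnit_of_le 1 h isStrictlyPositive_one

lemma isUnit_of_isUnit_mul {R : Type*} [Ring R] {x y z : R} (h1 : IsUnit (y * x))
    (h2 : IsUnit (x * z)) : IsUnit x := by
  obtain ⟨u, hu⟩ := h1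
  obtain ⟨v, hv⟩ := h2
  refine isUnit_iff_exists_and_exists.2 ⟨⟨z * ↑v⁻¹, ?_⟩, ⟨↑u⁻¹ * y, ?_⟩⟩
  · rw [← mul_assoc, ← hv, v.mul_inv]
  · rw [mul_assoc, ← hu, u.inv_mul]

/-- An element with real part at least `1` is invertible. -/
lemma isUnit_of_two_le_add_star {x : A} (h : (2 : ℝ) • (1 : A) ≤ x + star x) : IsUnit x := by
  have h1 : 1 ≤ star x * x := by
    have h0 : 0 ≤ star (x - 1) * (x - 1) := star_mul_self_nonneg _
    have e : star x * x - 1 = star (x - 1) * (x - 1) + (x + star x - (2 : ℝ) • (1 : A)) := by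
      simp only [star_sub, star_one, sub_mul, mul_sub, mul_one, one_mul, two_smul]; abel
    rw [← sub_nonneg, e]
    exact add_nonneg h0 (sub_nonneg.2 h)
  have h2 : 1 ≤ x * star x := by
    have h0 : 0 ≤ (x - 1) * star (x - 1) := mul_star_self_nonneg _
    have e : x * star x - 1 = (x - 1) * star (x - 1) + (x + star x - (2 : ℝ) • (1 : A)) := by
      simp only [star_sub, star_one, sub_mul, mul_sub, mul_one, one_mul, two_smul]; abel
    rw [← sub_nonneg, e]
    exact add_nonneg h0 (sub_nonneg.2 h)
  exact isUnit_of_isUnit_mul (isUnit_of_one_le h1) (isUnit_of_one_le h2)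

/-- The Cayley transform of an element with nonnegative real part is a contraction. -/
lemma norm_cayley_le_one {p : A} (h : 0 ≤ p + star p) :
    ‖(p - 1) * Ring.inverse (p + 1)‖ ≤ 1 := by
  have hu : IsUnit (p + 1) := by
    apply isUnit_of_two_le_add_star
    rw [← sub_nonneg]
    convert h using 1
    simp only [star_add, star_one, two_smul]; abel
  refine norm_le_of_star_mul_self_le zero_le_one ?_
  rw [one_pow, one_smul, star_mul]
  have h1 : star (p - 1) * (p - 1) ≤ star (p + 1) * (p + 1) := by
    rw [← sub_nonneg]
    have : star (p + 1) * (p + 1) - star (p - 1) * (p - 1) = (2 : ℝ) • (p + star p) := by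
      simp only [star_sub, star_add, star_one, sub_mul, mul_sub, mul_one, one_mul, two_smul,
        add_mul, mul_add]; abel
    rw [this]
    exact smul_nonneg zero_le_two h
  have h2 := star_left_conjugate_le_conjugate h1 (Ring.inverse (p + 1))
  have e : star (Ring.inverse (p + 1)) * (star (p + 1) * (p + 1)) * Ring.inverse (p + 1) = 1 := by
    rw [mul_assoc, mul_assoc, Ring.mul_inverse_cancel _ hu, mul_one, ← star_mul,
      Ring.mul_inverse_cancel _ hu, star_one]
  rw [e] at h2
  simpa [mul_assoc] using h2

/-- For a contraction `y` the element `(1 + y)(1 - y)⁻¹` has nonnegative real part. -/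
lemma add_star_cayley_nonneg {y : A} (hy : ‖y‖ < 1) :
    0 ≤ ((2 : ℝ) • Ring.inverse (1 - y) - 1) + star ((2 : ℝ) • Ring.inverse (1 - y) - 1) := by
  have hu : IsUnit (1 - y) := isUnit_one_sub_of_norm_lt_one hy
  set w := Ring.inverse (1 - y) with hw
  have hw1 : (1 - y) * w = 1 := Ring.mul_inverse_cancel _ hu
  have hw2 : star w * star (1 - y) = 1 := by rw [← star_mul, hw1, star_one]
  have h1 : 0 ≤ (2 : ℝ) • (1 - star y * y) := by
    refine smul_nonneg zero_le_two (sub_nonneg.2 ((star_mul_self_le_smul_one y).trans ?_))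
    have : ‖y‖ ^ 2 ≤ 1 := by nlinarith [norm_nonneg y]
    simpa using smul_one_mono (A := A) this
  have h2 := star_left_conjugate_nonneg h1 w
  have e : star w * ((2 : ℝ) • (1 - star y * y)) * w
      = ((2 : ℝ) • w - 1) + star ((2 : ℝ) • w - 1) := by
    have e1 : 1 - star y * y = star (1 - y) + (1 - y) - star (1 - y) * (1 - y) := by
      simp only [star_sub, star_one, sub_mul, mul_sub, mul_one, one_mul]; abel
    have e2 : star w * (1 - star y * y) * w = w + star w - 1 := by
      rw [e1, mul_sub, mul_add, sub_mul, add_mul, hw2, one_mul, mul_assoc (star w) (1 - y), hw1,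
        mul_one, ← mul_assoc (star w), hw2, one_mul, hw1]
    rw [mul_smul_comm, smul_mul_assoc, e2]
    simp only [star_sub, star_add, star_one, two_smul]; abel
  rwa [e] at h2

/-- **Russo–Dye**: a positive subunital map is a contraction. -/
lemma PosPreserving.norm_apply_le_of_norm_lt {G : A →L[ℂ] A} (hG : PosPreserving G)
    (h1 : G 1 ≤ 1) {y : A} (hy : ‖y‖ < 1) : ‖G y‖ ≤ 1 := by
  have hyz : ∀ ζ ∈ Metric.ball (0 : ℂ) 1, ‖ζ • y‖ < 1 := by
    intro ζ hζ
    rw [mem_ball_zero_iff] at hζ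
    rw [norm_smul]
    nlinarith [norm_nonneg y, norm_nonneg ζ]
  set w : ℂ → A := fun ζ => Ring.inverse (1 - ζ • y) with hw
  set P : ℂ → A := fun ζ => G ((2 : ℝ) • w ζ - 1) + (1 - G 1) with hP
  have hwd : ∀ ζ ∈ Metric.ball (0 : ℂ) 1, DifferentiableAt ℂ w ζ := by
    intro ζ hζ
    have hu : IsUnit (1 - ζ • y) := isUnit_one_sub_of_norm_lt_one (hyz ζ hζ)
    have h2 : DifferentiableAt ℂ (fun ζ : ℂ => 1 - ζ • y) ζ := by fun_prop
    exact DifferentiableAt.fun_comp' (g := Ring.inverse) (f := fun ζ : ℂ => 1 - ζ • y) ζ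
      (differentiableAt_inverse hu) h2
  have hPd : ∀ ζ ∈ Metric.ball (0 : ℂ) 1, DifferentiableAt ℂ P ζ := by
    intro ζ hζ
    have h2 : DifferentiableAt ℂ (fun ζ => (2 : ℝ) • w ζ - 1) ζ := by
      have := hwd ζ hζ
      simp only [two_smul]
      fun_prop
    have h3 : DifferentiableAt ℂ (fun ζ => G ((2 : ℝ) • w ζ - 1)) ζ :=
      DifferentiableAt.fun_comp' (g := G) (f := fun ζ => (2 : ℝ) • w ζ - 1) ζ
        G.differentiableAt h2
    exact h3.add_const _
  have hPre : ∀ ζ ∈ Metric.ball (0 : ℂ) 1, 0 ≤ P ζ + star (P ζ) := by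
    intro ζ hζ
    have e : P ζ + star (P ζ) = G (((2 : ℝ) • w ζ - 1) + star ((2 : ℝ) • w ζ - 1))
        + ((1 - G 1) + (1 - G 1)) := by
      have : star (G 1) = G 1 := by rw [← hG.map_star, star_one]
      rw [map_add, hG.map_star, hP]
      simp only [star_add, star_sub, star_one, this]; abel
    rw [e]
    have h0 : 0 ≤ 1 - G 1 := sub_nonneg.2 h1
    exact add_nonneg (hG _ (add_star_cayley_nonneg (hyz ζ hζ))) (add_nonneg h0 h0)
  have hPu : ∀ ζ ∈ Metric.ball (0 : ℂ) 1, IsUnit (P ζ + 1) := by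
    intro ζ hζ
    apply isUnit_of_two_le_add_star
    rw [← sub_nonneg]
    convert hPre ζ hζ using 1
    simp only [star_add, star_one, two_smul]; abel
  have hw0 : w 0 = 1 := by simp [hw]
  have hP0 : P 0 = 1 := by simp [hP, hw0, two_smul]
  have key : ∀ ζ ∈ Metric.ball (0 : ℂ) 1, ‖P ζ - 1‖ ≤ ‖ζ‖ * ‖P ζ + 1‖ := by
    intro ζ hζ
    have hs := Complex.norm_le_norm_of_mapsTo_ball (R := 1) (z := ζ)
      (f := fun ζ => (P ζ - 1) * Ring.inverse (P ζ + 1)) ?_ ?_ ?_ (mem_ball_zero_iff.1 hζ)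
    · calc ‖P ζ - 1‖ = ‖(P ζ - 1) * Ring.inverse (P ζ + 1) * (P ζ + 1)‖ := by
            rw [mul_assoc, Ring.inverse_mul_cancel _ (hPu ζ hζ), mul_one]
        _ ≤ _ := (norm_mul_le _ _).trans (by gcongr)
    · intro ξ hξ
      refine DifferentiableAt.differentiableWithinAt ?_
      exact ((hPd ξ hξ).sub_const 1).mul
        (DifferentiableAt.fun_comp' (g := Ring.inverse) (f := fun ζ => P ζ + 1) ξ
          (differentiableAt_inverse (hPu ξ hξ)) ((hPd ξ hξ).add_const 1))
    · intro ξ hξ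
      exact mem_closedBall_zero_iff.2 (norm_cayley_le_one (hPre ξ hξ))
    · simp [hP0]
  have key2 : ∀ ζ ∈ Metric.ball (0 : ℂ) 1, ζ ≠ 0 → ‖(2 : ℝ) • G (y * w ζ)‖ ≤ ‖P ζ + 1‖ := by
    intro ζ hζ hne
    have hu : IsUnit (1 - ζ • y) := isUnit_one_sub_of_norm_lt_one (hyz ζ hζ)
    have e : P ζ - 1 = ζ • (2 : ℝ) • G (y * w ζ) := by
      have e1 : w ζ - 1 = ζ • (y * w ζ) := by
        have := Ring.mul_inverse_cancel _ hu
        rw [sub_mul, one_mul, smul_mul_assoc] at this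
        rw [← this]; simp [hw]
      have e2 : P ζ - 1 = (2 : ℝ) • G (w ζ - 1) := by
        simp only [hP, map_sub, map_add, two_smul]; abel
      rw [e2, e1, map_smul, smul_comm]
    have := key ζ hζ
    rw [e, norm_smul] at this
    exact le_of_mul_le_mul_left this (norm_pos_iff.2 hne)
  have hmem : Metric.ball (0 : ℂ) 1 ∈ nhds (0 : ℂ) := Metric.ball_mem_nhds _ one_pos
  have h0mem : (0 : ℂ) ∈ Metric.ball (0 : ℂ) 1 := Metric.mem_ball_self one_pos
  have hwc : Filter.Tendsto w (nhdsWithin 0 {0}ᶜ) (nhds 1) := by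
    have := (hwd 0 h0mem).continuousAt.tendsto
    rw [hw0] at this
    exact this.mono_left nhdsWithin_le_nhds
  have hPc : Filter.Tendsto P (nhdsWithin 0 {0}ᶜ) (nhds 1) := by
    have := (hPd 0 h0mem).continuousAt.tendsto
    rw [hP0] at this
    exact this.mono_left nhdsWithin_le_nhds
  have hl : Filter.Tendsto (fun ζ => ‖(2 : ℝ) • G (y * w ζ)‖) (nhdsWithin 0 {0}ᶜ)
      (nhds ‖(2 : ℝ) • G (y * 1)‖) :=
    (((G.continuous.tendsto _).comp (hwc.const_mul y)).const_smul (2 : ℝ)).norm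
  have hr : Filter.Tendsto (fun ζ => ‖P ζ + 1‖) (nhdsWithin 0 {0}ᶜ) (nhds ‖(1 : A) + 1‖) :=
    (hPc.add_const 1).norm
  have hle := le_of_tendsto_of_tendsto hl hr (by
    filter_upwards [self_mem_nhdsWithin, mem_nhdsWithin_of_mem_nhds hmem] with ζ h1 h2
    exact key2 ζ h2 h1)
  rw [mul_one, norm_smul] at hle
  have h2 : ‖(1 : A) + 1‖ ≤ 2 := by
    nontriviality A
    exact (norm_add_le _ _).trans (by rw [CStarRing.norm_one]; norm_num)
  have : ‖(2 : ℝ)‖ = 2 := by norm_num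
  rw [this] at hle
  linarith

/-- A positive map with `G 1 ≤ r` has norm at most `r`. -/
lemma PosPreserving.norm_apply_le {G : A →L[ℂ] A} (hG : PosPreserving G) {r : ℝ} (hr : 0 < r)
    (h1 : G 1 ≤ r • (1 : A)) (y : A) : ‖G y‖ ≤ r * ‖y‖ := by
  set G' : A →L[ℂ] A := ((r⁻¹ : ℝ) : ℂ) • G with hG'
  have hG'a : ∀ x, G' x = r⁻¹ • G x := fun x => by
    rw [hG']
    change ((r⁻¹ : ℝ) : ℂ) • G x = _
    rw [Complex.coe_smul]
  have hpos : PosPreserving G' := fun x hx => by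
    rw [hG'a]; exact smul_nonneg (inv_nonneg.2 hr.le) (hG x hx)
  have hone : G' 1 ≤ 1 := by
    rw [hG'a]
    have := smul_le_smul_of_nonneg_left h1 (inv_nonneg.2 hr.le)
    rwa [smul_smul, inv_mul_cancel₀ hr.ne', one_smul] at this
  have key : ∀ t : ℝ, ‖y‖ < t → ‖G y‖ ≤ r * t := by
    intro t ht
    have ht0 : 0 < t := (norm_nonneg y).trans_lt ht
    have := hpos.norm_apply_le_of_norm_lt hone (y := t⁻¹ • y) (by
      rw [norm_smul, norm_inv, Real.norm_of_nonneg ht0.le, inv_mul_lt_iff₀ ht0]; simpa using ht)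
    rw [hG'a, map_real_smul, norm_smul, norm_smul, norm_inv, norm_inv,
      Real.norm_of_nonneg ht0.le, Real.norm_of_nonneg hr.le, inv_mul_le_iff₀ hr,
      inv_mul_le_iff₀ ht0] at this
    linarith
  refine le_of_forall_gt_imp_ge_of_dense fun s hs => ?_
  have := key (s / r) (by rwa [lt_div_iff₀ hr, mul_comm])
  rwa [mul_div_cancel₀ _ hr.ne'] at this

lemma reA_isSelfAdjoint (x : A) : IsSelfAdjoint (reA x) := by
  rw [IsSelfAdjoint, reA, star_smul, star_add, star_star, add_comm]
  congr 1
  simp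

lemma imA_isSelfAdjoint (x : A) : IsSelfAdjoint (imA x) := by
  rw [IsSelfAdjoint, imA, star_smul, star_sub, star_star, ← neg_sub x, smul_neg, ← neg_smul]
  congr 1
  simp

lemma eq_star_add_imA (x : A) : x = star x + (2 * Complex.I) • imA x := by
  rw [imA, smul_smul, mul_inv_cancel₀ (by simp), one_smul]; abel

lemma reA_add_I_smul_imA (x : A) : reA x + Complex.I • imA x = x := by
  have h : Complex.I * (2 * Complex.I)⁻¹ = 2⁻¹ := by
    rw [mul_inv, mul_comm (2 : ℂ)⁻¹, ← mul_assoc, mul_inv_cancel₀ Complex.I_ne_zero, one_mul]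
  rw [reA, imA, smul_smul, h, ← smul_add, add_add_sub_cancel, ← two_smul ℂ x, smul_smul,
    inv_mul_cancel₀ two_ne_zero, one_smul]

lemma imA_add (x y : A) : imA (x + y) = imA x + imA y := by
  rw [imA, imA, imA, ← smul_add, star_add]; congr 1; abel

lemma imA_sub (x y : A) : imA (x - y) = imA x - imA y := by
  rw [imA, imA, imA, ← smul_sub, star_sub]; congr 1; abel

lemma imA_of_isSelfAdjoint {x : A} (h : IsSelfAdjoint x) : imA x = 0 := by
  rw [imA, h.star_eq, sub_self, smul_zero]

lemma imA_smul_one (z : ℂ) : imA (z • (1 : A)) = z.im • (1 : A) := by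
  rw [imA, star_smul, star_one, ← sub_smul, smul_smul, ← Complex.coe_smul]
  congr 1
  rw [Complex.star_def, Complex.sub_conj]
  field_simp
  simp

lemma norm_imA_le (x : A) : ‖imA x‖ ≤ ‖x‖ := by
  rw [imA, norm_smul]
  have h1 : ‖(2 * Complex.I)⁻¹‖ = 2⁻¹ := by simp
  have h2 : ‖x - star x‖ ≤ ‖x‖ + ‖x‖ := (norm_sub_le _ _).trans (by rw [norm_star])
  rw [h1]; linarith

lemma PosPreserving.map_imA {S : A →L[ℂ] A} (hS : PosPreserving S) (x : A) :
    S (imA x) = imA (S x) := by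
  rw [imA, imA, map_smul, map_sub, hS.map_star]

lemma TracialState.tr_imA (φ : TracialState A) (x : A) : φ.tr (imA x) = ((φ.tr x).im : ℂ) := by
  rw [imA, map_smul, map_sub, φ.tr_star, smul_eq_mul, Complex.star_def, Complex.sub_conj]
  field_simp
  simp

lemma nrm2_smul (φ : TracialState A) (c : ℂ) (x : A) : nrm2 φ (c • x) = ‖c‖ * nrm2 φ x := by
  rw [nrm2_eq_preGNS, nrm2_eq_preGNS, map_smul, norm_smul]

lemma nrm2_imA_le (φ : TracialState A) (x : A) : nrm2 φ (imA x) ≤ nrm2 φ x := by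
  rw [imA, sub_eq_add_neg, ← neg_one_smul ℂ (star x), nrm2_smul]
  have h := nrm2_add_le φ x ((-1 : ℂ) • star x)
  rw [nrm2_smul φ (-1) (star x), nrm2_star, norm_neg, norm_one, one_mul] at h
  have h1 : ‖(2 * Complex.I)⁻¹‖ = 2⁻¹ := by simp
  rw [h1]
  linarith

lemma nrm2_reA_le (φ : TracialState A) (x : A) : nrm2 φ (reA x) ≤ nrm2 φ x := by
  rw [reA, nrm2_smul]
  have h := nrm2_add_le φ x (star x)
  rw [nrm2_star] at h
  have h1 : ‖(2 : ℂ)⁻¹‖ = 2⁻¹ := by simp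
  rw [h1]
  linarith

section Flat

variable {φ : TracialState A} {S : A →L[ℂ] A} {c₁ c₂ : ℝ}

lemma IsFlat.le (hF : IsFlat φ S c₁ c₂) {x : A} (hx : 0 ≤ x) :
    (c₁ * (φ.tr x).re) • (1 : A) ≤ S x := by
  have := (hF x hx).1; rwa [Complex.coe_smul] at this

lemma IsFlat.ge (hF : IsFlat φ S c₁ c₂) {x : A} (hx : 0 ≤ x) :
    S x ≤ (c₂ * (φ.tr x).re) • (1 : A) := by
  have := (hF x hx).2; rwa [Complex.coe_smul] at this

lemma IsFlat.norm_apply_le (hF : IsFlat φ S c₁ c₂) (hS : PosPreserving S) (h2 : 0 < c₂) (x : A) :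
    ‖S x‖ ≤ c₂ * ‖x‖ := by
  refine hS.norm_apply_le h2 ?_ x
  simpa [φ.unital] using hF.ge zero_le_one

lemma IsFlat.apply_le (hF : IsFlat φ S c₁ c₂) (hS : PosPreserving S) (h2 : 0 < c₂) {x : A}
    (hx : IsSelfAdjoint x) {δ : ℝ} (hδ : nrm2 φ x < δ) : S x ≤ (c₂ * δ) • (1 : A) := by
  have hδ0 : 0 < δ := (nrm2_nonneg φ x).trans_lt hδ
  have h0 : 0 ≤ star (x - δ • (1 : A)) * (x - δ • (1 : A)) := star_mul_self_nonneg _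
  have e : star (x - δ • (1 : A)) * (x - δ • (1 : A))
      = (star x * x + (δ ^ 2) • (1 : A)) - (2 * δ) • x := by
    simp only [star_sub, star_smul, star_one, star_trivial, hx.star_eq, sub_mul, mul_sub,
      smul_mul_assoc, mul_smul_comm, one_mul, mul_one, smul_smul, sq, two_mul, add_smul, smul_sub]
    abel
  rw [e, sub_nonneg] at h0
  have h3 : 0 ≤ star x * x + (δ ^ 2) • (1 : A) :=
    add_nonneg (star_mul_self_nonneg _) (smul_nonneg (sq_nonneg _) zero_le_one)
  have h4 := (hS.mono h0).trans (hF.ge h3)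
  rw [map_add, φ.tr_real_smul_one, Complex.add_re, ← nrm2_sq, Complex.ofReal_re,
    map_real_smul] at h4
  have h5 : c₂ * (nrm2 φ x ^ 2 + δ ^ 2) ≤ (2 * δ) * (c₂ * δ) := by
    have : nrm2 φ x ^ 2 ≤ δ ^ 2 := by
      have := nrm2_nonneg φ x
      gcongr
    nlinarith
  have h6 := smul_le_smul_of_nonneg_left (h4.trans (smul_one_mono h5))
    (inv_nonneg.2 (by positivity : 0 ≤ 2 * δ))
  rwa [smul_smul, smul_smul, inv_mul_cancel₀ (by positivity), one_smul,
    inv_mul_cancel_left₀ (by positivity)] at h6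

lemma IsFlat.norm_apply_le_nrm2_of_isSelfAdjoint (hF : IsFlat φ S c₁ c₂) (hS : PosPreserving S)
    (h2 : 0 < c₂) {x : A} (hx : IsSelfAdjoint x) : ‖S x‖ ≤ c₂ * nrm2 φ x := by
  have := φ.nontrivial
  have key : ∀ δ, nrm2 φ x < δ → ‖S x‖ ≤ c₂ * δ := by
    intro δ hδ
    have hδ' : nrm2 φ (-x) < δ := by
      rw [← neg_one_smul ℂ, nrm2_smul]; simpa using hδ
    refine norm_le_of_abs_le_smul_one ?_ ?_ (hF.apply_le hS h2 hx hδ)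
    · rw [IsSelfAdjoint, ← hS.map_star, hx.star_eq]
    · have := hF.apply_le hS h2 hx.neg hδ'
      rw [map_neg] at this
      exact neg_le.1 this
  refine le_of_forall_gt_imp_ge_of_dense fun s hs => ?_
  have := key (s / c₂) (by rwa [lt_div_iff₀ h2, mul_comm])
  rwa [mul_div_cancel₀ _ h2.ne'] at this

lemma IsFlat.norm_apply_le_nrm2 (hF : IsFlat φ S c₁ c₂) (hS : PosPreserving S)
    (h2 : 0 < c₂) (x : A) : ‖S x‖ ≤ 2 * c₂ * nrm2 φ x := by
  rw [← reA_add_I_smul_imA x, map_add, map_smul]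
  refine (norm_add_le _ _).trans ?_
  rw [norm_smul, Complex.norm_I, one_mul]
  have a1 := hF.norm_apply_le_nrm2_of_isSelfAdjoint hS h2 (reA_isSelfAdjoint x)
  have a2 := hF.norm_apply_le_nrm2_of_isSelfAdjoint hS h2 (imA_isSelfAdjoint x)
  have a3 := nrm2_reA_le φ x
  have a4 := nrm2_imA_le φ x
  rw [reA_add_I_smul_imA x]
  nlinarith

end Flat

/-- Positive definite elements have invertible self-adjoint square roots. -/
lemma exists_sqrt {V : A} {ε : ℝ} (hε : 0 < ε) (h : ε • (1 : A) ≤ V) :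
    ∃ k j : A, IsSelfAdjoint k ∧ IsSelfAdjoint j ∧ k * k = V ∧ k * j = 1 ∧ j * k = 1 := by
  have h0 : 0 ≤ V := (smul_nonneg hε.le zero_le_one).trans h
  have hu : IsUnit V := by
    have h1 := smul_le_smul_of_nonneg_left h (inv_nonneg.2 hε.le)
    rw [smul_smul, inv_mul_cancel₀ hε.ne', one_smul] at h1
    have h2 := isUnit_of_one_le h1
    have h3 : IsUnit (ε • (1 : A)) := by
      rw [← Algebra.algebraMap_eq_smul_one]
      exact (IsUnit.mk0 ε hε.ne').map (algebraMap ℝ A)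
    have h4 := h3.mul h2
    rwa [smul_mul_assoc, one_mul, smul_smul, mul_inv_cancel₀ hε.ne', one_smul] at h4
  have hk : CFC.sqrt V * CFC.sqrt V = V := CFC.sqrt_mul_sqrt_self V h0
  have hks : IsSelfAdjoint (CFC.sqrt V) := (CFC.sqrt_nonneg V).isSelfAdjoint
  have hku : IsUnit (CFC.sqrt V) := isUnit_of_isUnit_mul (by rwa [hk]) (by rwa [hk])
  obtain ⟨u, hu⟩ := hku
  refine ⟨CFC.sqrt V, ↑u⁻¹, hks, ?_, hk, ?_, ?_⟩
  · have h1 : star (↑u : A) = u := by rw [hu]; exact hks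
    have h2 : (↑u : A) * star (↑u⁻¹ : A) = 1 := by
      nth_rw 1 [← h1]
      rw [← star_mul, u.inv_mul, star_one]
    exact Units.eq_inv_of_mul_eq_one_left h2
  · rw [← hu, u.mul_inv]
  · rw [← hu, u.inv_mul]

/-- Quantitative control on a value `m` of the solution of the Dyson equation with
`w = -m⁻¹`, `V = Im m` and `R = Im w`. -/
structure Controlled (φ : TracialState A) (S : A →L[ℂ] A) (c₁ c₂ : ℝ) (m w V R : A) (q : ℝ) :
    Prop where
  pos : PosPreserving S
  flat : IsFlat φ S c₁ c₂
  mul_eq : m * w = -1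
  mul_eq' : w * m = -1
  imA_eq : imA m = V
  selfAdjoint_R : IsSelfAdjoint R
  conj_eq : m * R * star m = V
  conj_eq' : star m * R * m = V
  apply_le : S V ≤ R
  two_le : 2 ≤ q
  norm_m : ‖m‖ ≤ q
  norm_w : ‖w‖ ≤ q
  norm_V : ‖V‖ ≤ q
  norm_R : ‖R‖ ≤ q
  c₂_pos : 0 < c₂
  c₂_le : c₂ ≤ q
  le_c₁ : q⁻¹ ≤ c₁
  le_V : q⁻¹ • (1 : A) ≤ V
  le_R : q⁻¹ • (1 : A) ≤ R

/-- The stability operator `x ↦ m S[x] m` without the identity. -/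
def sandwich (S : A →L[ℂ] A) (m : A) : A →L[ℂ] A :=
  (ContinuousLinearMap.mulLeftRight ℂ A m m).comp S

lemma sandwich_apply (S : A →L[ℂ] A) (m x : A) : sandwich S m x = m * S x * m := by
  simp [sandwich]

lemma norm_sq_le_of_mul_self_eq {k V : A} (hk : IsSelfAdjoint k) (h : k * k = V) {q : ℝ}
    (hV : ‖V‖ ≤ q) : ‖k‖ * ‖k‖ ≤ q := by
  rw [← CStarRing.norm_star_mul_self, hk.star_eq, h]; exact hV

lemma norm_inv_sq_le {k j V : A} (hj : IsSelfAdjoint j) (h : k * k = V)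
    (hkj : k * j = 1) (hjk : j * k = 1) {q : ℝ} (hq : 0 < q) (hV : q⁻¹ • (1 : A) ≤ V) :
    ‖j‖ * ‖j‖ ≤ q := by
  rw [← CStarRing.norm_star_mul_self]
  refine norm_le_of_nonneg_of_le_smul_one hq.le (star_mul_self_nonneg j) ?_
  have h1 := star_left_conjugate_le_conjugate hV j
  have e : star j * V * j = 1 := by
    rw [hj.star_eq, ← h, ← mul_assoc, hjk, one_mul, hkj]
  rw [e, mul_smul_comm, smul_mul_assoc, mul_one] at h1
  have h2 := smul_le_smul_of_nonneg_left h1 hq.le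
  rwa [smul_smul, mul_inv_cancel₀ hq.ne', one_smul] at h2

/-- The sandwiched map `y ↦ j S[k y k] j`. -/
def conjMap (S : A →L[ℂ] A) (k j : A) : A →L[ℂ] A :=
  ((ContinuousLinearMap.mulLeftRight ℂ A j j).comp S).comp
    (ContinuousLinearMap.mulLeftRight ℂ A k k)

lemma conjMap_apply (S : A →L[ℂ] A) (k j y : A) : conjMap S k j y = j * S (k * y * k) * j := by
  simp [conjMap]

/-- The trace as a continuous linear map into the scalars of the algebra. -/
def TracialState.trOne (φ : TracialState A) : A →L[ℂ] A :=
  ContinuousLinearMap.smulRight (⟨φ.tr, φ.cont⟩ : A →L[ℂ] ℂ) (1 : A)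

lemma TracialState.trOne_apply (φ : TracialState A) (x : A) : φ.trOne x = φ.tr x • (1 : A) := rfl

lemma TracialState.trOne_apply_of_nonneg (φ : TracialState A) {x : A} (hx : 0 ≤ x) :
    φ.trOne x = (φ.tr x).re • (1 : A) := by
  rw [φ.trOne_apply, ← Complex.coe_smul]
  congr 1
  exact Complex.ext rfl (φ.state_pos x hx).2

lemma IsSelfAdjoint.conj_nonneg' {k x : A} (hk : IsSelfAdjoint k) (hx : 0 ≤ x) :
    0 ≤ k * x * k := by
  have := star_left_conjugate_nonneg hx k
  rwa [hk.star_eq] at this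

lemma IsSelfAdjoint.conj_mono' {k x y : A} (hk : IsSelfAdjoint k) (hx : x ≤ y) :
    k * x * k ≤ k * y * k := by
  have := star_left_conjugate_le_conjugate hx k
  rwa [hk.star_eq] at this

lemma TracialState.mul_tr_le_tr_conj (φ : TracialState A) {k V y : A} {ε : ℝ}
    (h : k * k = V) (hV : ε • (1 : A) ≤ V) (hy : 0 ≤ y) :
    ε * (φ.tr y).re ≤ (φ.tr (k * y * k)).re := by
  obtain ⟨t, ht⟩ := CStarAlgebra.nonneg_iff_eq_star_mul_self.1 hy
  have e1 : φ.tr (k * y * k) = φ.tr (t * V * star t) := by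
    rw [mul_assoc, φ.tracial, mul_assoc, h, ht, mul_assoc, φ.tracial]
  have h1 := φ.tr_re_mono (star_right_conjugate_le_conjugate hV t)
  rw [← e1, mul_smul_comm, mul_one, smul_mul_assoc, φ.tr_real_smul, φ.tracial, ← ht] at h1
  simpa using h1

section

variable {φ : TracialState A} {S : A →L[ℂ] A} {c₁ c₂ : ℝ} {m w V R : A} {q : ℝ}

/-- The sandwiched map dominates a multiple of the trace, hence has a spectral gap. -/
lemma Controlled.norm_conjMap_le (h : Controlled φ S c₁ c₂ m w V R q)
    {k k' j' : A} (hk : IsSelfAdjoint k) (hkV : k * k = V)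
    (hj' : IsSelfAdjoint j') (hkR : k' * k' = R) (hkj' : k' * j' = 1) (hjk' : j' * k' = 1)
    (y : A) :
    ‖conjMap S k j' y‖ ≤ (q ^ 3)⁻¹ * ‖φ.tr y‖ + (1 - (q ^ 3)⁻¹) * ‖y‖ := by
  have hq2 := h.two_le
  have hq : 0 < q := by linarith
  set κ : ℝ := (q ^ 3)⁻¹ with hκ
  have hκ0 : 0 < κ := by positivity
  have hκ1 : κ < 1 := by
    rw [hκ]
    exact inv_lt_one_of_one_lt₀ (one_lt_pow₀ (by linarith) (by norm_num))
  set G : A →L[ℂ] A := conjMap S k j' - (κ : ℂ) • φ.trOne with hG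
  have hGa : ∀ x, G x = conjMap S k j' x - κ • φ.trOne x := fun x => by
    change _ - (κ : ℂ) • φ.trOne x = _
    rw [Complex.coe_smul]; rfl
  have hjj : q⁻¹ • (1 : A) ≤ j' * j' := by
    have h1 : R ≤ q • (1 : A) := (le_norm_smul_one h.selfAdjoint_R).trans (smul_one_mono h.norm_R)
    have h2 := IsSelfAdjoint.conj_mono' hj' h1
    have e : j' * R * j' = 1 := by rw [← hkR, ← mul_assoc, hjk', one_mul, hkj']
    rw [e, mul_smul_comm, smul_mul_assoc, mul_one] at h2
    have h3 := smul_le_smul_of_nonneg_left h2 (inv_nonneg.2 hq.le)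
    rwa [smul_smul, inv_mul_cancel₀ hq.ne', one_smul] at h3
  have hpos : PosPreserving G := by
    intro x hx
    rw [hGa, sub_nonneg, conjMap_apply, φ.trOne_apply_of_nonneg hx, smul_smul]
    have h1 := IsSelfAdjoint.conj_mono' hj' (h.flat.le (IsSelfAdjoint.conj_nonneg' hk hx))
    refine le_trans ?_ h1
    rw [mul_smul_comm, smul_mul_assoc, mul_one]
    have h2 := φ.mul_tr_le_tr_conj hkV h.le_V hx
    have h0 := φ.tr_re_nonneg hx
    have h3 : 0 ≤ c₁ * (φ.tr (k * x * k)).re :=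
      mul_nonneg ((inv_nonneg.2 hq.le).trans h.le_c₁)
        (φ.tr_re_nonneg (IsSelfAdjoint.conj_nonneg' hk hx))
    refine le_trans ?_ (smul_le_smul_of_nonneg_left hjj h3)
    rw [smul_smul]
    apply smul_one_mono
    have h4 : q⁻¹ * (q⁻¹ * (φ.tr x).re) ≤ c₁ * (φ.tr (k * x * k)).re := by
      have := h.le_c₁
      have : 0 ≤ q⁻¹ * (φ.tr x).re := by positivity
      have : 0 ≤ c₁ := (inv_nonneg.2 hq.le).trans h.le_c₁
      gcongr
    calc κ * (φ.tr x).re = q⁻¹ * (q⁻¹ * (φ.tr x).re) * q⁻¹ := by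
          rw [hκ]; field_simp
      _ ≤ _ := by gcongr
  have hone : G 1 ≤ (1 - κ) • (1 : A) := by
    rw [hGa, sub_smul, one_smul, φ.trOne_apply, φ.unital, one_smul, conjMap_apply, mul_one, hkV]
    gcongr
    have h2 := IsSelfAdjoint.conj_mono' hj' h.apply_le
    have e : j' * R * j' = 1 := by rw [← hkR, ← mul_assoc, hjk', one_mul, hkj']
    rwa [e] at h2
  have hRD := hpos.norm_apply_le (by linarith) hone y
  have e : conjMap S k j' y = κ • φ.trOne y + G y := by rw [hGa]; abel
  rw [e]
  refine (norm_add_le _ _).trans (add_le_add ?_ hRD)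
  have := φ.nontrivial
  rw [norm_smul, φ.trOne_apply, norm_smul, Real.norm_of_nonneg hκ0.le, CStarRing.norm_one, mul_one]

lemma Controlled.lower_bound_aux {q ε D : ℝ} (hq : 2 ≤ q) (hε : 0 ≤ ε) (hD : 0 ≤ D)
    (hD2 : D ^ 2 ≤ 2 * q ^ 3 * ε)
    (h : q⁻¹ * q⁻¹ ≤ q * ε * q * q + q * D * q * q + q * (2 * q * (q * D))) :
    1 ≤ q ^ 20 * ε := by
  by_contra! hlt
  have hq0 : 0 < q := by linarith
  have h16 : (2 : ℝ) ^ 16 ≤ q ^ 16 := by gcongr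
  have h1 : (q ^ 8 * D) ^ 2 ≤ 1 := by
    have : q ^ 17 * D ^ 2 ≤ 2 := by
      calc q ^ 17 * D ^ 2 ≤ q ^ 17 * (2 * q ^ 3 * ε) := by gcongr
        _ = 2 * (q ^ 20 * ε) := by ring
        _ ≤ 2 := by linarith
    have h2 : 2 * (q ^ 8 * D) ^ 2 ≤ q ^ 17 * D ^ 2 := by
      calc 2 * (q ^ 8 * D) ^ 2 ≤ q * (q ^ 8 * D) ^ 2 := by gcongr
        _ = q ^ 17 * D ^ 2 := by ring
    linarith
  have h2 : q ^ 8 * D ≤ 1 := by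
    have : 0 ≤ q ^ 8 * D := by positivity
    nlinarith
  have h3 : 8 * (q ^ 5 * D) ≤ 1 := by
    have : (2 : ℝ) ^ 3 ≤ q ^ 3 := by gcongr
    calc 8 * (q ^ 5 * D) = 2 ^ 3 * (q ^ 5 * D) := by norm_num
      _ ≤ q ^ 3 * (q ^ 5 * D) := by gcongr
      _ = q ^ 8 * D := by ring
      _ ≤ 1 := h2
  have h4 : 8 * (q ^ 5 * ε) ≤ 1 := by
    have : (2 : ℝ) ^ 3 ≤ q ^ 15 := by
      calc (2 : ℝ) ^ 3 ≤ 2 ^ 15 := by norm_num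
        _ ≤ q ^ 15 := by gcongr
    calc 8 * (q ^ 5 * ε) = 2 ^ 3 * (q ^ 5 * ε) := by norm_num
      _ ≤ q ^ 15 * (q ^ 5 * ε) := by gcongr
      _ = q ^ 20 * ε := by ring
      _ ≤ 1 := hlt.le
  have h5 : q ^ 2 * (q⁻¹ * q⁻¹) = 1 := by field_simp
  have h6 : q ^ 2 * (q⁻¹ * q⁻¹) ≤
      q ^ 2 * (q * ε * q * q + q * D * q * q + q * (2 * q * (q * D))) := by gcongr
  rw [h5] at h6
  have h7 : q ^ 2 * (q * ε * q * q + q * D * q * q + q * (2 * q * (q * D)))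
      = q ^ 5 * ε + 3 * (q ^ 5 * D) := by ring
  linarith

/-- The stability estimate after normalisation. -/
lemma Controlled.one_le_of_normalized (h : Controlled φ S c₁ c₂ m w V R q)
    {k : A} (hk : IsSelfAdjoint k) (hkV : k * k = V) {y e : A} (hy : ‖y‖ = 1) (htr : φ.tr y = (‖φ.tr y‖ : ℂ))
    (hgap : 1 ≤ ‖e‖ + ((q ^ 3)⁻¹ * ‖φ.tr y‖ + (1 - (q ^ 3)⁻¹)))
    (he : k * y * k = k * e * k + m * S (k * y * k) * m) :
    1 ≤ q ^ 20 * ‖e‖ := by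
  have hq2 := h.two_le
  have hq : 0 < q := by linarith
  set D := nrm2 φ (1 - y) with hD
  have hkk : ‖k‖ * ‖k‖ ≤ q := norm_sq_le_of_mul_self_eq hk hkV h.norm_V
  have htrs : φ.tr (star y) = (‖φ.tr y‖ : ℂ) := by
    rw [φ.tr_star, htr]; simp
  have hD2 : D ^ 2 ≤ 2 * q ^ 3 * ‖e‖ := by
    have e1 : D ^ 2 = 1 - 2 * ‖φ.tr y‖ + nrm2 φ y ^ 2 := by
      rw [hD, nrm2_sq, nrm2_sq]
      have : star (1 - y) * (1 - y) = 1 - y - star y + star y * y := by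
        simp only [star_sub, star_one, sub_mul, mul_sub, one_mul, mul_one]; abel
      rw [this, map_add, map_sub, map_sub, φ.unital, htrs]
      nth_rw 1 [htr]
      simp; ring
    have e2 : nrm2 φ y ^ 2 ≤ 1 := by
      have := nrm2_le_norm φ y
      have := nrm2_nonneg φ y
      nlinarith
    have e3 : 1 - ‖φ.tr y‖ ≤ q ^ 3 * ‖e‖ := by
      have : (q ^ 3)⁻¹ * (1 - ‖φ.tr y‖) ≤ ‖e‖ := by linarith
      rwa [inv_mul_le_iff₀ (by positivity)] at this
    linarith
  set d := 1 - y with hd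
  clear_value D d
  have hkdk : k * y * k = V - k * d * k := by
    rw [hd, mul_sub, sub_mul, mul_one, hkV]; abel
  -- pairing the equation with `w`
  have hpair : φ.tr ((k * y * k) * w) = φ.tr (k * e * k * w) - φ.tr (m * S (k * y * k)) := by
    nth_rw 1 [he]
    rw [add_mul, map_add, mul_assoc (m * _) m w, h.mul_eq, mul_neg, mul_one, map_neg]; ring
  have hVw : V * w = -(star m * R) := by
    rw [← h.conj_eq', mul_assoc, h.mul_eq, mul_neg, mul_one]
  have hbal : φ.tr (m * S V) - φ.tr (star m * R)
      = φ.tr (k * e * k * w) + φ.tr (k * d * k * w) + φ.tr (m * S (k * d * k)) := by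
    rw [hkdk, sub_mul, map_sub, hVw, map_sub S, mul_sub, map_sub, map_neg] at hpair
    linear_combination hpair
  have hVsa : IsSelfAdjoint V := h.imA_eq ▸ imA_isSelfAdjoint m
  have hV0 : 0 ≤ V := (smul_nonneg (inv_nonneg.2 hq.le) zero_le_one).trans h.le_V
  have him : q⁻¹ * q⁻¹ ≤ (φ.tr (m * S V) - φ.tr (star m * R)).im := by
    have hpairV : ∀ B : A, IsSelfAdjoint B → (φ.tr (m * B)).im = (φ.tr (k * B * k)).re ∧
        (φ.tr (star m * B)).im = -(φ.tr (k * B * k)).re := by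
      intro B hB
      have e0 : φ.tr (k * B * k) = φ.tr (V * B) := by
        rw [φ.tracial, ← mul_assoc, hkV]
      have e1 : φ.tr (m * B) = φ.tr (star m * B) + 2 * Complex.I * φ.tr (V * B) := by
        nth_rw 1 [eq_star_add_imA m]
        rw [h.imA_eq, add_mul, smul_mul_assoc, map_add, map_smul, smul_eq_mul]
      have e2 : φ.tr (m * B) = star (φ.tr (star m * B)) := by
        rw [← φ.tr_star, star_mul, star_star, hB.star_eq, φ.tracial]
      have e3 : (φ.tr (m * B)).im = -(φ.tr (star m * B)).im := by rw [e2]; simp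
      have e4 := congrArg Complex.im e1
      simp at e4
      rw [e0]
      constructor <;> linarith
    have hSV : 0 ≤ S V := h.pos V hV0
    have h1 := (hpairV (S V) hSV.isSelfAdjoint).1
    have h2 := (hpairV R h.selfAdjoint_R).2
    have h3 : 0 ≤ (φ.tr (k * S V * k)).re := φ.tr_re_nonneg (IsSelfAdjoint.conj_nonneg' hk hSV)
    have h4 : q⁻¹ * q⁻¹ ≤ (φ.tr (k * R * k)).re := by
      have h5 := φ.mul_tr_le_tr_conj (y := R) hkV h.le_V
        ((smul_nonneg (inv_nonneg.2 hq.le) zero_le_one).trans h.le_R)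
      have h6 := φ.tr_re_mono h.le_R
      rw [φ.tr_real_smul_one, Complex.ofReal_re] at h6
      have : q⁻¹ * q⁻¹ ≤ q⁻¹ * (φ.tr R).re := by gcongr
      linarith
    rw [Complex.sub_im, h1, h2]; linarith
  have hub : ‖φ.tr (m * S V) - φ.tr (star m * R)‖
      ≤ q * ‖e‖ * q * q + q * D * q * q + q * (2 * q * (q * D)) := by
    rw [hbal]
    have hD0 : 0 ≤ D := hD ▸ nrm2_nonneg _ _
    have hkdk2 : nrm2 φ (k * d * k) ≤ q * D := by
      calc nrm2 φ (k * d * k) ≤ nrm2 φ (k * d) * ‖k‖ := nrm2_mul_le_right _ _ _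
        _ ≤ (‖k‖ * D) * ‖k‖ := by gcongr; exact (nrm2_mul_le_left _ _ _).trans_eq (by rw [hD])
        _ = (‖k‖ * ‖k‖) * D := by ring
        _ ≤ q * D := by gcongr
    have b1 : ‖φ.tr (k * e * k * w)‖ ≤ q * ‖e‖ * q * q := by
      calc ‖φ.tr (k * e * k * w)‖ ≤ ‖k * e * k * w‖ := norm_tr_le _ _
        _ ≤ ‖k‖ * ‖e‖ * ‖k‖ * ‖w‖ := by
            refine (norm_mul_le _ _).trans ?_
            gcongr
            refine (norm_mul_le _ _).trans ?_
            gcongr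
            exact norm_mul_le _ _
        _ = (‖k‖ * ‖k‖) * ‖e‖ * ‖w‖ := by ring
        _ ≤ q * ‖e‖ * q := by gcongr; exact h.norm_w
        _ ≤ q * ‖e‖ * q * q := le_mul_of_one_le_right (by positivity) (by linarith)
    have b2 : ‖φ.tr (k * d * k * w)‖ ≤ q * D * q * q := by
      calc ‖φ.tr (k * d * k * w)‖ ≤ nrm2 φ (k * d * k) * ‖w‖ := norm_tr_mul_le _ _ _
        _ ≤ q * D * q := by gcongr; exact h.norm_w
        _ ≤ q * D * q * q := le_mul_of_one_le_right (by positivity) (by linarith)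
    have b3 : ‖φ.tr (m * S (k * d * k))‖ ≤ q * (2 * q * (q * D)) := by
      calc ‖φ.tr (m * S (k * d * k))‖ ≤ ‖m * S (k * d * k)‖ := norm_tr_le _ _
        _ ≤ ‖m‖ * ‖S (k * d * k)‖ := norm_mul_le _ _
        _ ≤ q * (2 * c₂ * nrm2 φ (k * d * k)) := by
            gcongr
            · exact h.norm_m
            · exact h.flat.norm_apply_le_nrm2 h.pos h.c₂_pos _
        _ ≤ q * (2 * q * (q * D)) := by
            have := nrm2_nonneg φ (k * d * k)
            have := h.c₂_le
            gcongr
    exact (norm_add₃_le).trans (by linarith)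
  exact Controlled.lower_bound_aux hq2 (norm_nonneg e) (hD ▸ nrm2_nonneg _ _) hD2
    (him.trans ((Complex.abs_im_le_norm _).trans' (le_abs_self _) |>.trans hub))

end

/-- The method of continuity for `1 - T`. -/
lemma isUnit_one_sub_of_forall_norm_le {E : Type*} [NormedAddCommGroup E] [NormedSpace ℂ E]
    [CompleteSpace E] {T : E →L[ℂ] E} {K : ℝ} (hK0 : 0 < K)
    (h : ∀ s : ℝ, 0 ≤ s → s ≤ 1 → ∀ x : E, ‖x‖ ≤ K * ‖x - (s : ℂ) • T x‖) :
    IsUnit (1 - T) := by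
  obtain ⟨n, hn⟩ := exists_nat_gt (K * ‖T‖)
  have hn0 : (0 : ℝ) < n := lt_of_le_of_lt (by positivity) hn
  have key : ∀ i : ℕ, i ≤ n → IsUnit (1 - ((i / n : ℝ) : ℂ) • T) := by
    intro i
    induction i with
    | zero => intro _; simp
    | succ i ih =>
      intro hi
      obtain ⟨u, hu⟩ := ih (by omega)
      set v : E →L[ℂ] E := ((u⁻¹ : (E →L[ℂ] E)ˣ) : E →L[ℂ] E) with hv
      have huv : (u : E →L[ℂ] E) * v = 1 := u.mul_inv
      have hui : ‖v‖ ≤ K := by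
        refine ContinuousLinearMap.opNorm_le_bound _ hK0.le fun y => ?_
        have h1 := h (i / n : ℝ) (by positivity)
          (by rw [div_le_one hn0]; exact_mod_cast (by omega : i ≤ n)) (v y)
        have h2 : (u : E →L[ℂ] E) (v y) = y := congrArg (fun F : E →L[ℂ] E => F y) huv
        rw [hu] at h2
        change ‖_‖ ≤ K * ‖(1 - ((i / n : ℝ) : ℂ) • T) (v y)‖ at h1
        rwa [h2] at h1
      have e : 1 - (((i + 1 : ℕ) / n : ℝ) : ℂ) • T
          = u * (1 - ((n : ℂ)⁻¹) • (v * T)) := by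
        rw [mul_sub, mul_one, mul_smul_comm, ← mul_assoc, huv, one_mul, hu]
        push_cast
        rw [add_div, add_smul, one_div]; abel
      rw [e]
      refine u.isUnit.mul (isUnit_one_sub_of_norm_lt_one ?_)
      rw [norm_smul, norm_inv, Complex.norm_natCast, inv_mul_lt_iff₀ hn0, mul_one]
      exact ((norm_mul_le _ _).trans (by gcongr)).trans_lt hn
  have := key n le_rfl
  rwa [div_self hn0.ne', Complex.ofReal_one, one_smul] at this

section

variable {φ : TracialState A} {S : A →L[ℂ] A} {c₁ c₂ : ℝ} {m w V R : A} {q : ℝ}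

/-- The stability estimate for the conjugated variable. -/
lemma Controlled.norm_conj_le (h : Controlled φ S c₁ c₂ m w V R q)
    {k j : A} (hk : IsSelfAdjoint k) (hj : IsSelfAdjoint j) (hkV : k * k = V)
    (hkj : k * j = 1) (hjk : j * k = 1) (x : A) {s : ℝ} (hs0 : 0 ≤ s) (hs1 : s ≤ 1) :
    ‖j * x * j‖ ≤ 2 * (q ^ 20 * ‖j * (x - (s : ℂ) • sandwich S m x) * j‖) := by
  have hN := φ.nontrivial
  have hq2 := h.two_le
  have hq : 0 < q := by linarith
  obtain ⟨k', j', hk', hj', hkR, hkj', hjk'⟩ := exists_sqrt (inv_pos.2 hq) h.le_R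
  have hU : ‖j * m * k'‖ ≤ 1 := by
    have : ‖j * m * k'‖ * ‖j * m * k'‖ = 1 := by
      rw [← CStarRing.norm_self_mul_star]
      simp only [star_mul, hk'.star_eq, hj.star_eq]
      have : j * m * k' * (k' * (star m * j)) = j * (m * (k' * k') * star m) * j := by
        simp only [mul_assoc]
      rw [this, hkR, h.conj_eq, ← hkV, ← mul_assoc, hjk, one_mul, hkj, CStarRing.norm_one]
    nlinarith [norm_nonneg (j * m * k')]
  have hU' : ‖k' * m * j‖ ≤ 1 := by
    have : ‖k' * m * j‖ * ‖k' * m * j‖ = 1 := by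
      rw [← CStarRing.norm_star_mul_self]
      simp only [star_mul, hk'.star_eq, hj.star_eq]
      have : j * (star m * k') * (k' * m * j) = j * (star m * (k' * k') * m) * j := by
        simp only [mul_assoc]
      rw [this, hkR, h.conj_eq', ← hkV, ← mul_assoc, hjk, one_mul, hkj, CStarRing.norm_one]
    nlinarith [norm_nonneg (k' * m * j)]
  have hkjx : ∀ x : A, k * (j * x * j) * k = x := fun x => by
    rw [mul_assoc j, ← mul_assoc, hkj, one_mul, mul_assoc, hjk, mul_one]
  have hT : ∀ x : A, ‖j * sandwich S m x * j‖ ≤ ‖conjMap S k j' (j * x * j)‖ := by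
    intro x
    have e : j * sandwich S m x * j
        = (j * m * k') * conjMap S k j' (j * x * j) * (k' * m * j) := by
      rw [conjMap_apply, hkjx, sandwich_apply]
      have : j * m * k' * (j' * S x * j') * (k' * m * j)
          = j * m * (k' * j') * S x * (j' * k') * m * j := by simp only [mul_assoc]
      rw [this, hkj', hjk', mul_one, mul_one]; simp only [mul_assoc]
    rw [e]
    calc _ ≤ ‖j * m * k'‖ * ‖conjMap S k j' (j * x * j)‖ * ‖k' * m * j‖ :=
          (norm_mul_le _ _).trans (by gcongr; exact norm_mul_le _ _)
      _ ≤ 1 * ‖conjMap S k j' (j * x * j)‖ * 1 := by gcongr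
      _ = _ := by ring
  have hgap := fun y => h.norm_conjMap_le hk hkV hj' hkR hkj' hjk' y
  -- the case `s = 1`
  have key : ∀ x : A, ‖j * x * j‖ = 1 →
      φ.tr (j * x * j) = (‖φ.tr (j * x * j)‖ : ℂ) →
      1 ≤ q ^ 20 * ‖j * (x - sandwich S m x) * j‖ := by
    intro x hx htr
    refine h.one_le_of_normalized hk hkV hx htr ?_ ?_
    · have e : j * x * j = j * (x - sandwich S m x) * j + j * sandwich S m x * j := by
        rw [mul_sub, sub_mul]; abel
      have h1 := hgap (j * x * j)
      rw [hx, mul_one] at h1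
      calc 1 = ‖j * x * j‖ := hx.symm
        _ ≤ ‖j * (x - sandwich S m x) * j‖ + ‖j * sandwich S m x * j‖ :=
            (congrArg _ e).trans_le (norm_add_le _ _)
        _ ≤ _ := add_le_add le_rfl ((hT x).trans h1)
    · rw [hkjx, hkjx, ← sandwich_apply]; abel
  have key2 : ∀ x : A, ‖j * x * j‖ ≤ q ^ 20 * ‖j * (x - sandwich S m x) * j‖ := by
    intro x
    by_cases hx : j * x * j = 0
    · rw [hx, norm_zero]; positivity
    obtain ⟨c, hc, hc2⟩ := RCLike.exists_norm_eq_mul_self (K := ℂ) (φ.tr (j * x * j))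
    have hn := norm_pos_iff.2 hx
    set b : ℂ := c * (‖j * x * j‖ : ℂ)⁻¹ with hb
    have hb1 : ‖b‖ = ‖j * x * j‖⁻¹ := by rw [hb, norm_mul, hc, one_mul]; simp
    have e1 : j * (b • x) * j = b • (j * x * j) := by rw [mul_smul_comm, smul_mul_assoc]
    have h1 := key (b • x) (by rw [e1, norm_smul, hb1, inv_mul_cancel₀ hn.ne']) (by
      rw [e1, map_smul, smul_eq_mul, norm_mul, hb1, hb]
      push_cast
      rw [mul_right_comm, ← hc2, mul_comm]; rfl)
    have e2 : j * (b • x - sandwich S m (b • x)) * j = b • (j * (x - sandwich S m x) * j) := by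
      rw [map_smul, ← smul_sub, mul_smul_comm, smul_mul_assoc]
    rw [e2, norm_smul, hb1, mul_left_comm, le_inv_mul_iff₀ hn, mul_one] at h1
    exact h1
  have hFle : ‖j * sandwich S m x * j‖ ≤ ‖j * x * j‖ := by
    refine (hT x).trans ((hgap _).trans ?_)
    have h1 : (q ^ 3)⁻¹ * ‖φ.tr (j * x * j)‖ ≤ (q ^ 3)⁻¹ * ‖j * x * j‖ := by
      gcongr; exact norm_tr_le φ _
    linarith
  have e : j * (x - (s : ℂ) • sandwich S m x) * j
      = j * x * j - s • (j * sandwich S m x * j) := by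
    rw [Complex.coe_smul, mul_sub, sub_mul, mul_smul_comm, smul_mul_assoc]
  have a1 : (1 - s) * ‖j * x * j‖ ≤ ‖j * (x - (s : ℂ) • sandwich S m x) * j‖ := by
    rw [e]
    have := norm_sub_norm_le (j * x * j) (s • (j * sandwich S m x * j))
    rw [norm_smul, Real.norm_of_nonneg hs0] at this
    nlinarith
  have a2 : ‖j * (x - sandwich S m x) * j‖
      ≤ ‖j * (x - (s : ℂ) • sandwich S m x) * j‖ + (1 - s) * ‖j * x * j‖ := by
    have : j * (x - sandwich S m x) * j = j * (x - (s : ℂ) • sandwich S m x) * j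
        - (1 - s) • (j * sandwich S m x * j) := by
      rw [e, mul_sub, sub_mul, sub_smul, one_smul]; abel
    rw [this]
    refine (norm_sub_le _ _).trans ?_
    rw [norm_smul, Real.norm_of_nonneg (by linarith : 0 ≤ 1 - s)]
    have : 0 ≤ 1 - s := by linarith
    gcongr
  refine (key2 x).trans ?_
  have : 0 < q ^ 20 := by positivity
  nlinarith

/-- **Linear stability** of the Dyson equation. -/
lemma Controlled.norm_le (h : Controlled φ S c₁ c₂ m w V R q) (x : A) {s : ℝ}
    (hs0 : 0 ≤ s) (hs1 : s ≤ 1) :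
    ‖x‖ ≤ q ^ 23 * ‖x - (s : ℂ) • sandwich S m x‖ := by
  have hq2 := h.two_le
  have hq : 0 < q := by linarith
  obtain ⟨k, j, hk, hj, hkV, hkj, hjk⟩ := exists_sqrt (inv_pos.2 hq) h.le_V
  have h1 := h.norm_conj_le hk hj hkV hkj hjk x hs0 hs1
  have hkk := norm_sq_le_of_mul_self_eq hk hkV h.norm_V
  have hjj := norm_inv_sq_le hj hkV hkj hjk hq h.le_V
  have hkjx : k * (j * x * j) * k = x := by
    rw [mul_assoc j, ← mul_assoc, hkj, one_mul, mul_assoc, hjk, mul_one]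
  have hb : ∀ k x : A, ‖k * x * k‖ ≤ ‖k‖ * ‖k‖ * ‖x‖ := fun k x =>
    calc ‖k * x * k‖ ≤ ‖k‖ * ‖x‖ * ‖k‖ :=
          (norm_mul_le _ _).trans (by gcongr; exact norm_mul_le _ _)
      _ = _ := by ring
  set e := x - (s : ℂ) • sandwich S m x
  calc ‖x‖ = ‖k * (j * x * j) * k‖ := by rw [hkjx]
    _ ≤ ‖k‖ * ‖k‖ * ‖j * x * j‖ := hb _ _
    _ ≤ q * (2 * (q ^ 20 * ‖j * e * j‖)) := by gcongr
    _ ≤ q * (2 * (q ^ 20 * (‖j‖ * ‖j‖ * ‖e‖))) := by gcongr; exact hb _ _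
    _ ≤ q * (q * (q ^ 20 * (q * ‖e‖))) := by gcongr
    _ = q ^ 23 * ‖e‖ := by ring

/-- The stability operator is invertible. -/
lemma Controlled.isUnit_one_sub_sandwich (h : Controlled φ S c₁ c₂ m w V R q) :
    IsUnit (1 - sandwich S m) := by
  have hq2 := h.two_le
  exact isUnit_one_sub_of_forall_norm_le (K := q ^ 23) (by positivity)
    fun s hs0 hs1 x => h.norm_le x hs0 hs1

end

section LocalToGlobal

variable {E : Type*} [NormedAddCommGroup E]

lemma norm_sub_le_of_eventually_right {F : ℝ → E} {L : ℝ}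
    (hF : ContinuousOn F (Set.Icc 0 1))
    (h : ∀ t ∈ Set.Ico (0 : ℝ) 1, ∀ᶠ s in nhdsWithin t (Set.Ioi t), ‖F s - F t‖ ≤ L * (s - t)) :
    ‖F 1 - F 0‖ ≤ L := by
  have := image_le_of_liminf_slope_right_le_deriv_boundary (f := fun t => ‖F t - F 0‖)
    (a := 0) (b := 1) (B := fun t => L * t) (B' := fun _ => L)
    (hF.sub continuousOn_const).norm (by simp) (by fun_prop)
    (fun x _ => by simpa using ((hasDerivAt_id x).const_mul L).hasDerivWithinAt) (by
      intro x hx r hr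
      refine Filter.Eventually.frequently ?_
      filter_upwards [h x hx, self_mem_nhdsWithin] with s hs hxs
      have hxs' : 0 < s - x := sub_pos.2 hxs
      rw [slope_def_field, div_lt_iff₀ hxs']
      have h1 : ‖F s - F 0‖ ≤ ‖F s - F x‖ + ‖F x - F 0‖ := norm_sub_le_norm_sub_add_norm_sub _ _ _
      nlinarith) (Set.right_mem_Icc.2 zero_le_one)
  simpa using this

/-- A locally Lipschitz function on a convex set, with a uniform constant, is Lipschitz. -/
lemma norm_sub_le_of_locally_lipschitz {Ω : Set ℂ} (hΩ : Convex ℝ Ω) {G : ℂ → E} {L : ℝ}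
    (hG : ContinuousOn G Ω)
    (h : ∀ z ∈ Ω, ∀ᶠ z' in nhdsWithin z Ω, ‖G z' - G z‖ ≤ L * ‖z' - z‖) {z z' : ℂ}
    (hz : z ∈ Ω) (hz' : z' ∈ Ω) : ‖G z' - G z‖ ≤ L * ‖z' - z‖ := by
  set γ : ℝ → ℂ := fun t => z + t • (z' - z) with hγ
  have hγc : Continuous γ := by fun_prop
  have hγΩ : ∀ t ∈ Set.Icc (0 : ℝ) 1, γ t ∈ Ω := fun t ht =>
    hΩ.add_smul_sub_mem hz hz' ht
  have := norm_sub_le_of_eventually_right (F := fun t => G (γ t)) (L := L * ‖z' - z‖)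
    (hG.comp hγc.continuousOn hγΩ) (by
      intro t ht
      have h1 : Filter.Tendsto γ (nhdsWithin t (Set.Ioi t)) (nhdsWithin (γ t) Ω) := by
        refine tendsto_nhdsWithin_of_tendsto_nhds_of_eventually_within _
          (hγc.continuousAt.tendsto.mono_left nhdsWithin_le_nhds) ?_
        filter_upwards [Ioo_mem_nhdsGT ht.2] with s hs
        exact hγΩ s ⟨ht.1.trans hs.1.le, hs.2.le⟩
      filter_upwards [h1.eventually (h (γ t) (hγΩ t ⟨ht.1, ht.2.le⟩)), self_mem_nhdsWithin]
        with s hs hts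
      have e : γ s - γ t = (s - t) • (z' - z) := by simp only [hγ]; rw [sub_smul]; ring
      have hts' : 0 < s - t := sub_pos.2 hts
      rw [e, norm_smul, Real.norm_of_nonneg hts'.le] at hs
      linarith)
  simpa [hγ] using this

end LocalToGlobal

/-- A data pair with the solution of the Dyson equation and its representing measure, where
all model parameters are dominated by the single constant `P`. -/
structure Sys (φ : TracialState A) (P c₁ c₂ : ℝ) (a : A) (S : A →L[ℂ] A) (m : ℂ → A)
    (v : OpMeasure A φ) : Prop where
  sa : IsSelfAdjoint a
  norm_a : ‖a‖ ≤ P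
  pos : PosPreserving S
  flat : IsFlat φ S c₁ c₂
  sol : IsDysonSolution a S m
  univ : v.val Set.univ = 1
  rep : StieltjesRep φ v m
  three_le : 3 ≤ P
  c₁_pos : 0 < c₁
  inv_c₁_le : c₁⁻¹ ≤ P
  c₂_pos : 0 < c₂
  c₂_le : c₂ ≤ P

/-- The element `z - a + S x`. -/
def dysonW (a : A) (S : A →L[ℂ] A) (z : ℂ) (x : A) : A := z • (1 : A) - a + S x

lemma imA_dysonW {a : A} (ha : IsSelfAdjoint a) {S : A →L[ℂ] A} (hS : PosPreserving S) (z : ℂ)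
    (x : A) : imA (dysonW a S z x) = z.im • (1 : A) + S (imA x) := by
  rw [dysonW, imA_add, imA_sub, imA_smul_one, imA_of_isSelfAdjoint ha, sub_zero, hS.map_imA]

lemma conj_imA_eq {x w : A} (h : x * w = -1) (h' : w * x = -1) :
    x * imA w * star x = imA x ∧ star x * imA w * x = imA x := by
  have hs : star w * star x = -1 := by rw [← star_mul, h, star_neg, star_one]
  have hs' : star x * star w = -1 := by rw [← star_mul, h', star_neg, star_one]
  constructor
  · rw [imA, imA, mul_smul_comm, smul_mul_assoc, mul_sub, sub_mul, h, mul_assoc x, hs]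
    congr 1; simp only [neg_one_mul, mul_neg, mul_one]; abel
  · rw [imA, imA, mul_smul_comm, smul_mul_assoc, mul_sub, sub_mul, hs', mul_assoc (star x), h']
    congr 1; simp only [neg_one_mul, mul_neg, mul_one]; abel

lemma norm_le_inv_of_le_imA {x w : A} (h : x * w = -1) (h' : w * x = -1) {ε : ℝ} (hε : 0 < ε)
    (hw : ε • (1 : A) ≤ imA w) : ‖x‖ ≤ ε⁻¹ := by
  have h1 := star_right_conjugate_le_conjugate hw x
  rw [(conj_imA_eq h h').1, mul_smul_comm, mul_one, smul_mul_assoc] at h1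
  have h2 := h1.trans ((le_norm_smul_one (imA_isSelfAdjoint x)).trans
    (smul_one_mono (norm_imA_le x)))
  have h3 : 0 ≤ ε • (x * star x) := smul_nonneg hε.le (mul_star_self_nonneg x)
  have h4 := norm_le_of_nonneg_of_le_smul_one (norm_nonneg x) h3 h2
  rw [norm_smul, CStarRing.norm_self_mul_star, Real.norm_of_nonneg hε.le] at h4
  rcases eq_or_lt_of_le (norm_nonneg x) with h0 | h0
  · rw [← h0]; positivity
  · rw [le_inv_comm₀ h0 hε, ← one_div, le_div_iff₀ h0]
    by_contra! hlt
    nlinarith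

lemma le_imA_of_le_imA {x w : A} (h : x * w = -1) (h' : w * x = -1) {ε W : ℝ} (hε : 0 ≤ ε)
    (hW : 0 < W) (hw : ε • (1 : A) ≤ imA w) (hwW : ‖w‖ ≤ W) :
    (ε / W ^ 2) • (1 : A) ≤ imA x := by
  have h1 := star_left_conjugate_le_conjugate hw x
  rw [(conj_imA_eq h h').2, mul_smul_comm, mul_one, smul_mul_assoc] at h1
  refine le_trans ?_ h1
  have h2 : star w * w ≤ (W ^ 2) • (1 : A) :=
    (star_mul_self_le_smul_one w).trans (smul_one_mono (by gcongr))
  have h3 := star_left_conjugate_le_conjugate h2 x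
  have e : star x * (star w * w) * x = 1 := by
    rw [mul_assoc, mul_assoc, h', ← mul_assoc, ← star_mul, h']; simp
  rw [e, mul_smul_comm, mul_one, smul_mul_assoc] at h3
  have h4 := smul_le_smul_of_nonneg_left h3 (by positivity : 0 ≤ ε / W ^ 2)
  rwa [smul_smul, div_mul_cancel₀ _ (by positivity)] at h4

lemma norm_dysonW_le (φ : TracialState A) (a : A) {S : A →L[ℂ] A} {c : ℝ}
    (hS : ∀ x, ‖S x‖ ≤ c * ‖x‖)
    (z : ℂ) (x : A) : ‖dysonW a S z x‖ ≤ ‖z‖ + ‖a‖ + c * ‖x‖ := by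
  have := φ.nontrivial
  rw [dysonW]
  refine (norm_add_le _ _).trans (add_le_add ((norm_sub_le _ _).trans ?_) (hS x))
  rw [norm_smul, CStarRing.norm_one, mul_one]

section Sys

variable {φ : TracialState A} {P c₁ c₂ : ℝ} {a : A} {S : A →L[ℂ] A} {m : ℂ → A}
  {v : OpMeasure A φ}

lemma Sys.P_pos (h : Sys φ P c₁ c₂ a S m v) : 0 < P := by linarith [h.three_le]

lemma Sys.mul_w (h : Sys φ P c₁ c₂ a S m v) {z : ℂ} (hz : 0 < z.im) :
    m z * dysonW a S z (m z) = -1 := (h.sol z hz).2.1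

lemma Sys.w_mul (h : Sys φ P c₁ c₂ a S m v) {z : ℂ} (hz : 0 < z.im) :
    dysonW a S z (m z) * m z = -1 := (h.sol z hz).2.2

lemma Sys.norm_S_le (h : Sys φ P c₁ c₂ a S m v) (x : A) : ‖S x‖ ≤ P * ‖x‖ :=
  (h.flat.norm_apply_le h.pos h.c₂_pos x).trans (by gcongr; exact h.c₂_le)

lemma Sys.imA_nonneg (h : Sys φ P c₁ c₂ a S m v) {z : ℂ} (hz : 0 < z.im) :
    0 ≤ imA (m z) := by
  obtain ⟨ε, hε, hle⟩ := (h.sol z hz).1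
  rw [Complex.coe_smul] at hle
  exact (smul_nonneg hε.le zero_le_one).trans hle

lemma TracialState.tr_imA_re (φ : TracialState A) (x : A) :
    (φ.tr (imA x)).re = (φ.tr x).im := by rw [φ.tr_imA, Complex.ofReal_re]

lemma Sys.tr_im_pos (h : Sys φ P c₁ c₂ a S m v) {z : ℂ} (hz : 0 < z.im) :
    0 < (φ.tr (m z)).im := by
  obtain ⟨ε, hε, hle⟩ := (h.sol z hz).1
  rw [Complex.coe_smul] at hle
  have := φ.tr_re_mono hle
  rw [φ.tr_real_smul_one, Complex.ofReal_re, φ.tr_imA_re] at this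
  linarith

lemma Sys.le_imA_w (h : Sys φ P c₁ c₂ a S m v) {z : ℂ} (hz : 0 < z.im) :
    (z.im + c₁ * (φ.tr (m z)).im) • (1 : A) ≤ imA (dysonW a S z (m z)) := by
  rw [imA_dysonW h.sa h.pos, add_smul]
  gcongr
  rw [← φ.tr_imA_re]
  exact h.flat.le (h.imA_nonneg hz)

lemma Sys.norm_le_inv (h : Sys φ P c₁ c₂ a S m v) {z : ℂ} (hz : 0 < z.im) :
    ‖m z‖ ≤ (z.im + c₁ * (φ.tr (m z)).im)⁻¹ :=
  norm_le_inv_of_le_imA (h.mul_w hz) (h.w_mul hz)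
    (add_pos hz (mul_pos h.c₁_pos (h.tr_im_pos hz))) (h.le_imA_w hz)

lemma Sys.norm_le_inv_im (h : Sys φ P c₁ c₂ a S m v) {z : ℂ} (hz : 0 < z.im) :
    ‖m z‖ ≤ z.im⁻¹ :=
  (h.norm_le_inv hz).trans (inv_anti₀ hz (by
    have := mul_pos h.c₁_pos (h.tr_im_pos hz); linarith))

lemma Sys.norm_le_of_le (h : Sys φ P c₁ c₂ a S m v) {z : ℂ} (hz : 0 < z.im) {p : ℝ}
    (hp : P ≤ p) (hr : p⁻¹ ≤ (φ.tr (m z)).im) : ‖m z‖ ≤ p ^ 2 := by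
  have hP := h.P_pos
  have hp0 : 0 < p := hP.trans_le hp
  refine (h.norm_le_inv hz).trans ?_
  have h1 : p⁻¹ ≤ c₁ := by
    rw [inv_le_comm₀ hp0 h.c₁_pos]; exact h.inv_c₁_le.trans hp
  have hc := h.c₁_pos
  have h2 : p⁻¹ * p⁻¹ ≤ z.im + c₁ * (φ.tr (m z)).im := by
    have : p⁻¹ * p⁻¹ ≤ c₁ * (φ.tr (m z)).im := by gcongr
    linarith
  refine (inv_anti₀ (by positivity) h2).trans_eq ?_
  rw [← mul_inv, inv_inv, sq]

lemma norm_tr_im_le (φ : TracialState A) (x : A) : (φ.tr x).im ≤ ‖x‖ :=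
  (le_abs_self _).trans ((Complex.abs_im_le_norm _).trans (norm_tr_le φ x))

lemma Sys.tr_im_le (h : Sys φ P c₁ c₂ a S m v) {z : ℂ} (hz : 0 < z.im) :
    (φ.tr (m z)).im ≤ P := by
  have hP := h.P_pos
  by_contra! hlt
  have h3 := h.three_le
  have h1 := h.norm_le_of_le hz le_rfl ((inv_le_one_of_one_le₀ (by linarith)).trans
    (by linarith))
  have h2 := h.norm_le_inv hz
  have h4 := norm_tr_im_le φ (m z)
  have hc := h.c₁_pos
  have hd : 0 < z.im + c₁ * (φ.tr (m z)).im := add_pos hz (mul_pos hc (h.tr_im_pos hz))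
  have h5 : P < (z.im + c₁ * (φ.tr (m z)).im)⁻¹ := by linarith
  rw [lt_inv_comm₀ hP hd] at h5
  have h6 : 1 ≤ c₁ * P := by
    have := h.inv_c₁_le
    rw [inv_le_iff_one_le_mul₀ hc] at this
    linarith
  have h7 : P⁻¹ ≤ 1 := inv_le_one_of_one_le₀ (by linarith)
  nlinarith

lemma Sys.norm_w_le (h : Sys φ P c₁ c₂ a S m v) {z : ℂ} (hzP : ‖z‖ ≤ P) :
    ‖dysonW a S z (m z)‖ ≤ P + P + P * ‖m z‖ :=
  (norm_dysonW_le φ a h.norm_S_le z (m z)).trans (by linarith [h.norm_a])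

/-- Quantitative control of the solution in terms of the harmonic extension. -/
lemma Sys.controlled (h : Sys φ P c₁ c₂ a S m v) {z : ℂ} (hz : 0 < z.im) (hzP : ‖z‖ ≤ P) {p : ℝ}
    (hp : P ≤ p) (hr : p⁻¹ ≤ (φ.tr (m z)).im) :
    Controlled φ S c₁ c₂ (m z) (dysonW a S z (m z)) (imA (m z)) (imA (dysonW a S z (m z)))
      (p ^ 10) := by
  have hP := h.P_pos
  have hp3 : 3 ≤ p := h.three_le.trans hp
  have hp1 : 1 ≤ p := by linarith
  have hp0 : 0 < p := by linarith
  have hm := h.norm_le_of_le hz hp hr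
  have hw : ‖dysonW a S z (m z)‖ ≤ p ^ 4 := by
    refine (h.norm_w_le hzP).trans ?_
    have h1 : P * ‖m z‖ ≤ p * p ^ 2 := by gcongr
    have h2 : p ≤ p ^ 3 := le_self_pow₀ hp1 (by norm_num)
    have h3 : 3 * p ^ 3 ≤ p * p ^ 3 := by gcongr
    nlinarith
  have hpow : ∀ n : ℕ, n ≤ 10 → p ^ n ≤ p ^ 10 := fun n hn => pow_le_pow_right₀ hp1 hn
  have hc1 : p⁻¹ ≤ c₁ := by
    rw [inv_le_comm₀ hp0 h.c₁_pos]; exact h.inv_c₁_le.trans hp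
  have hR : ((p ^ 2)⁻¹) • (1 : A) ≤ imA (dysonW a S z (m z)) := by
    refine le_trans (smul_one_mono ?_) (h.le_imA_w hz)
    have : p⁻¹ * p⁻¹ ≤ c₁ * (φ.tr (m z)).im := by
      have := h.c₁_pos
      gcongr
    rw [sq, mul_inv]; linarith
  exact
    { pos := h.pos
      flat := h.flat
      mul_eq := h.mul_w hz
      mul_eq' := h.w_mul hz
      imA_eq := rfl
      selfAdjoint_R := imA_isSelfAdjoint _
      conj_eq := (conj_imA_eq (h.mul_w hz) (h.w_mul hz)).1
      conj_eq' := (conj_imA_eq (h.mul_w hz) (h.w_mul hz)).2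
      apply_le := by
        rw [imA_dysonW h.sa h.pos]
        exact le_add_of_nonneg_left (smul_nonneg hz.le zero_le_one)
      two_le := by
        have := hpow 1 (by norm_num)
        linarith
      norm_m := hm.trans (hpow 2 (by norm_num))
      norm_w := hw.trans (hpow 4 (by norm_num))
      norm_V := (norm_imA_le _).trans (hm.trans (hpow 2 (by norm_num)))
      norm_R := (norm_imA_le _).trans (hw.trans (hpow 4 (by norm_num)))
      c₂_pos := h.c₂_pos
      c₂_le := by
        have := hpow 1 (by norm_num)
        linarith [h.c₂_le]
      le_c₁ := by
        refine le_trans ?_ hc1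
        have := hpow 1 (by norm_num)
        gcongr
        linarith
      le_V := by
        refine le_trans (smul_one_mono ?_) (le_imA_of_le_imA (h.mul_w hz) (h.w_mul hz)
          (by positivity) (by positivity : 0 < p ^ 4) hR hw)
        apply le_of_eq
        field_simp
      le_R := by
        refine le_trans (smul_one_mono ?_) hR
        have := hpow 2 (by norm_num)
        gcongr }

/-- A priori lower bound on the harmonic extension away from the real line. -/
lemma Sys.le_tr_im (h : Sys φ P c₁ c₂ a S m v) {z : ℂ} {η : ℝ} (hη : 0 < η) (hη1 : η ≤ 1)
    (hz : η ≤ z.im) (hzP : ‖z‖ ≤ P) : η ^ 3 / P ^ 4 ≤ (φ.tr (m z)).im := by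
  have hP := h.P_pos
  have h3 := h.three_le
  have hz0 : 0 < z.im := hη.trans_le hz
  have hw : ‖dysonW a S z (m z)‖ ≤ P ^ 2 / η := by
    refine (h.norm_w_le hzP).trans ?_
    have h1 : P * ‖m z‖ ≤ P * η⁻¹ := by
      gcongr; exact (h.norm_le_inv_im hz0).trans (inv_anti₀ hη hz)
    have h2 : 1 ≤ η⁻¹ := (one_le_inv₀ hη).2 hη1
    have h4 : P ≤ P * η⁻¹ := le_mul_of_one_le_right hP.le h2
    have h5 : 3 * (P * η⁻¹) ≤ P * (P * η⁻¹) := by gcongr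
    calc _ ≤ P * (P * η⁻¹) := by linarith
      _ = _ := by ring
  have hR : η • (1 : A) ≤ imA (dysonW a S z (m z)) := by
    refine le_trans (smul_one_mono ?_) (h.le_imA_w hz0)
    have := mul_pos h.c₁_pos (h.tr_im_pos hz0)
    linarith
  have h6 := φ.tr_re_mono (le_imA_of_le_imA (h.mul_w hz0) (h.w_mul hz0) hη.le
    (by positivity) hR hw)
  rw [φ.tr_real_smul_one, Complex.ofReal_re, φ.tr_imA_re] at h6
  refine le_trans (le_of_eq ?_) h6
  field_simp

lemma Sys.tr_quadratic (h : Sys φ P c₁ c₂ a S m v) (x : A) :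
    (v.scalar x).real Set.univ = (φ.tr (star x * x)).re := by
  have := v.compat x Set.univ MeasurableSet.univ
  rw [h.univ, mul_one] at this
  rw [this, Complex.ofReal_re]; rfl

lemma norm_inv_sub_inv_le {z z' : ℂ} (hz : 0 < z.im) (hz' : 0 < z'.im) (t : ℝ) :
    ‖((t : ℂ) - z)⁻¹ - ((t : ℂ) - z')⁻¹‖ ≤ ‖z - z'‖ / (z.im * z'.im) := by
  have key : ∀ z : ℂ, 0 < z.im → z.im ≤ ‖(t : ℂ) - z‖ := fun z hz => by
    have := Complex.abs_im_le_norm ((t : ℂ) - z)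
    simp only [Complex.sub_im, Complex.ofReal_im, zero_sub, abs_neg] at this
    exact (le_abs_self _).trans this
  have hne : ∀ z : ℂ, 0 < z.im → (t : ℂ) - z ≠ 0 := fun z hz =>
    norm_pos_iff.1 (hz.trans_le (key z hz))
  rw [inv_sub_inv (hne z hz) (hne z' hz'), norm_div, norm_mul]
  have e : (t : ℂ) - z' - ((t : ℂ) - z) = z - z' := by ring
  rw [e]
  gcongr
  · exact key z hz
  · exact key z' hz'

lemma norm_inv_sub_le {z : ℂ} (hz : 0 < z.im) (t : ℝ) : ‖((t : ℂ) - z)⁻¹‖ ≤ z.im⁻¹ := by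
  rw [norm_inv]
  have := Complex.abs_im_le_norm ((t : ℂ) - z)
  simp only [Complex.sub_im, Complex.ofReal_im, zero_sub, abs_neg] at this
  exact inv_anti₀ hz ((le_abs_self _).trans this)

lemma integrable_inv_sub {z : ℂ} (hz : 0 < z.im) (μ : Measure ℝ) [IsFiniteMeasure μ] :
    Integrable (fun t : ℝ => ((t : ℂ) - z)⁻¹) μ := by
  refine Integrable.of_bound (C := z.im⁻¹) ?_ (Filter.Eventually.of_forall (norm_inv_sub_le hz))
  exact Measurable.aestronglyMeasurable (by fun_prop)

/-- An element with small quadratic form has small norm. -/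
lemma norm_le_of_norm_tr_quadratic_le (φ : TracialState A) {D : A} {C : ℝ}
    (H : ∀ x : A, ‖φ.tr (star x * D * x)‖ ≤ C * (φ.tr (star x * x)).re) : ‖D‖ ≤ 2 * C := by
  have := φ.nontrivial
  have hstar : ∀ x : A, φ.tr (star x * star D * x) = star (φ.tr (star x * D * x)) := by
    intro x
    rw [← φ.tr_star]; simp only [star_mul, star_star, mul_assoc]
  have hre : ∀ x : A, (φ.tr (star x * reA D * x)).re = (φ.tr (star x * D * x)).re := by
    intro x
    rw [reA, mul_smul_comm, smul_mul_assoc, map_smul, mul_add, add_mul, map_add, hstar,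
      smul_eq_mul, Complex.star_def, Complex.add_conj]
    simp
  have him : ∀ x : A, (φ.tr (star x * imA D * x)).re = (φ.tr (star x * D * x)).im := by
    intro x
    rw [imA, mul_smul_comm, smul_mul_assoc, map_smul, mul_sub, sub_mul, map_sub, hstar,
      smul_eq_mul, Complex.star_def, Complex.sub_conj]
    have : (2 * Complex.I)⁻¹ * (((2 * (φ.tr (star x * D * x)).im : ℝ) : ℂ) * Complex.I)
        = ((φ.tr (star x * D * x)).im : ℂ) := by push_cast; field_simp
    rw [this, Complex.ofReal_re]
  have bd : ∀ B : A, IsSelfAdjoint B → (∀ x : A, |(φ.tr (star x * B * x)).re|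
      ≤ C * (φ.tr (star x * x)).re) → ‖B‖ ≤ C := by
    intro B hB hx
    refine norm_le_of_abs_le_smul_one hB ?_ ?_
    · rw [neg_le]
      refine le_smul_one_of_tr_le φ hB.neg fun x => ?_
      have := (abs_le.1 (hx x)).1
      simp only [mul_neg, neg_mul, map_neg, Complex.neg_re]
      linarith
    · exact le_smul_one_of_tr_le φ hB fun x => (le_abs_self _).trans (hx x)
  have h1 := bd _ (reA_isSelfAdjoint D) fun x => by
    rw [hre]; exact (Complex.abs_re_le_norm _).trans (H x)
  have h2 := bd _ (imA_isSelfAdjoint D) fun x => by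
    rw [him]; exact (Complex.abs_im_le_norm _).trans (H x)
  rw [← reA_add_I_smul_imA D]
  refine (norm_add_le _ _).trans ?_
  rw [norm_smul, Complex.norm_I, one_mul]
  linarith

lemma Sys.norm_sub_le (h : Sys φ P c₁ c₂ a S m v) {z z' : ℂ} (hz : 0 < z.im) (hz' : 0 < z'.im) :
    ‖m z - m z'‖ ≤ 2 * (‖z - z'‖ / (z.im * z'.im)) := by
  refine norm_le_of_norm_tr_quadratic_le φ fun x => ?_
  have := v.scalarFin x
  rw [mul_sub, sub_mul, map_sub, h.rep z hz x, h.rep z' hz' x,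
    ← integral_sub (integrable_inv_sub hz _) (integrable_inv_sub hz' _)]
  refine (norm_integral_le_of_norm_le_const
    (Filter.Eventually.of_forall (norm_inv_sub_inv_le hz hz'))).trans_eq ?_
  rw [h.tr_quadratic]

lemma Sys.continuousAt (h : Sys φ P c₁ c₂ a S m v) {z : ℂ} (hz : 0 < z.im) :
    ContinuousAt m z := by
  rw [ContinuousAt, tendsto_iff_norm_sub_tendsto_zero]
  have hev : ∀ᶠ z' in nhds z, 0 < z'.im :=
    (isOpen_lt continuous_const Complex.continuous_im).mem_nhds hz
  have ht : Filter.Tendsto (fun z' : ℂ => 2 * (‖z' - z‖ / (z'.im * z.im))) (nhds z) (nhds 0) := by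
    have : ContinuousAt (fun z' : ℂ => 2 * (‖z' - z‖ / (z'.im * z.im))) z := by
      refine continuousAt_const.mul (ContinuousAt.div ?_ ?_ (by positivity))
      · fun_prop
      · exact (Complex.continuous_im.mul continuous_const).continuousAt
    have h2 := this.tendsto
    simpa using h2
  refine squeeze_zero' (Filter.Eventually.of_forall fun _ => norm_nonneg _) ?_ ht
  filter_upwards [hev] with z' hz'
  exact h.norm_sub_le hz' hz

end Sys

lemma dyson_sub_eq {a a' : A} {S S' : A →L[ℂ] A} {z z' : ℂ} {x x' : A}
    (h : x * dysonW a S z x = -1) (h' : dysonW a' S' z' x' * x' = -1) :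
    x' - x = x * ((z' - z) • (1 : A) - (a' - a) + (S' - S) x') * x' + x * S (x' - x) * x' := by
  have e : dysonW a' S' z' x' - dysonW a S z x
      = ((z' - z) • (1 : A) - (a' - a) + (S' - S) x') + S (x' - x) := by
    simp only [dysonW, sub_smul, sub_apply, map_sub]; abel
  rw [← add_mul, ← mul_add, ← e, mul_sub, sub_mul, mul_assoc, h', h]
  simp only [mul_neg, mul_one, neg_mul, one_mul]
  abel

/-- Quantitative stability of the Dyson equation under perturbation of all its parameters. -/
lemma Controlled.norm_sub_le {φ : TracialState A} {c₁ c₂ : ℝ} {a a' : A} {S S' : A →L[ℂ] A}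
    {z z' : ℂ} {x x' V R : A} {p : ℝ}
    (hc : Controlled φ S c₁ c₂ x (dysonW a S z x) V R (p ^ 10)) (hp : 3 ≤ p)
    (hx : ‖x‖ ≤ p ^ 2) (hS : ∀ y, ‖S y‖ ≤ p * ‖y‖)
    (h' : dysonW a' S' z' x' * x' = -1) (hΔ : ‖x' - x‖ * p ^ 234 ≤ 1) :
    ‖x' - x‖ ≤ p ^ 236 * ‖(z' - z) • (1 : A) - (a' - a) + (S' - S) x'‖ := by
  set D := (z' - z) • (1 : A) - (a' - a) + (S' - S) x' with hD
  set Δ := x' - x with hΔd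
  have hp1 : 1 ≤ p := by linarith
  have hp0 : 0 < p := by linarith
  have e1 : Δ - ((1 : ℝ) : ℂ) • sandwich S x Δ = x * D * x' + x * S Δ * Δ := by
    have := dyson_sub_eq hc.mul_eq h'
    rw [← hD, ← hΔd] at this
    rw [sandwich_apply, Complex.ofReal_one, one_smul]
    nth_rewrite 1 [this]
    have e2 : x * S Δ * Δ = x * S Δ * x' - x * S Δ * x := by rw [hΔd]; noncomm_ring
    rw [e2]; abel
  have h1 := hc.norm_le Δ zero_le_one le_rfl
  rw [e1, ← pow_mul] at h1
  have hΔ1 : ‖Δ‖ ≤ 1 := by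
    have : 1 ≤ p ^ 234 := one_le_pow₀ hp1
    nlinarith [norm_nonneg Δ]
  have hx' : ‖x'‖ ≤ p ^ 2 + 1 := by
    have : x' = x + Δ := by rw [hΔd]; abel
    rw [this]
    exact (norm_add_le _ _).trans (add_le_add hx hΔ1)
  have h2 : ‖x * D * x'‖ ≤ p ^ 2 * ‖D‖ * (p ^ 2 + 1) :=
    (norm_mul_le _ _).trans (by
      gcongr
      exact (norm_mul_le _ _).trans (by gcongr))
  have h3 : ‖x * S Δ * Δ‖ ≤ p ^ 2 * (p * ‖Δ‖) * ‖Δ‖ :=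
    (norm_mul_le _ _).trans (by
      gcongr
      exact (norm_mul_le _ _).trans (by gcongr; exact hS Δ))
  have h4 : ‖Δ‖ ≤ p ^ 230 * (p ^ 2 * ‖D‖ * (p ^ 2 + 1) + p ^ 2 * (p * ‖Δ‖) * ‖Δ‖) :=
    h1.trans (by gcongr; exact (norm_add_le _ _).trans (add_le_add h2 h3))
  have h5 : 3 * (p ^ 230 * (p ^ 2 * (p * ‖Δ‖) * ‖Δ‖)) ≤ ‖Δ‖ := by
    calc 3 * (p ^ 230 * (p ^ 2 * (p * ‖Δ‖) * ‖Δ‖))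
        ≤ p * (p ^ 230 * (p ^ 2 * (p * ‖Δ‖) * ‖Δ‖)) := by gcongr
      _ = (‖Δ‖ * p ^ 234) * ‖Δ‖ := by ring
      _ ≤ 1 * ‖Δ‖ := by gcongr
      _ = _ := one_mul _
  have h6 : 2 * (p ^ 2 * (p ^ 2 + 1)) ≤ p ^ 6 := by
    have h9 : 9 ≤ p ^ 2 := by nlinarith
    nlinarith [sq_nonneg (p ^ 2)]
  calc ‖Δ‖ ≤ p ^ 230 * (2 * (p ^ 2 * (p ^ 2 + 1))) * ‖D‖ := by
        nlinarith [norm_nonneg D, norm_nonneg Δ]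
    _ ≤ p ^ 230 * p ^ 6 * ‖D‖ := by gcongr
    _ = _ := by ring

section Sys

variable {φ : TracialState A} {P c₁ c₂ : ℝ} {a : A} {S : A →L[ℂ] A} {m : ℂ → A}
  {v : OpMeasure A φ}

lemma Sys.mono (h : Sys φ P c₁ c₂ a S m v) {Q : ℝ} (hQ : P ≤ Q) : Sys φ Q c₁ c₂ a S m v :=
  { h with
    norm_a := h.norm_a.trans hQ
    three_le := h.three_le.trans hQ
    inv_c₁_le := h.inv_c₁_le.trans hQ
    c₂_le := h.c₂_le.trans hQ }

lemma eventually_im_pos {z : ℂ} (hz : 0 < z.im) : ∀ᶠ z' in nhds z, 0 < z'.im :=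
  (isOpen_lt continuous_const Complex.continuous_im).mem_nhds hz

/-- Local Lipschitz bound for the solution, uniform as long as the harmonic extension is bounded
from below. -/
lemma Sys.eventually_norm_sub_le (h : Sys φ P c₁ c₂ a S m v) {z : ℂ} (hz : 0 < z.im)
    (hzP : ‖z‖ ≤ P) {p : ℝ} (hp : P ≤ p) (hr : p⁻¹ ≤ (φ.tr (m z)).im) :
    ∀ᶠ z' in nhds z, ‖m z' - m z‖ ≤ p ^ 236 * ‖z' - z‖ := by
  have := φ.nontrivial
  have hp3 := h.three_le.trans hp
  have hp0 : 0 < p := by linarith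
  have ht : Filter.Tendsto (fun z' => ‖m z' - m z‖ * p ^ 234) (nhds z) (nhds 0) := by
    have := (tendsto_iff_norm_sub_tendsto_zero.1 (h.continuousAt hz).tendsto).mul_const (p ^ 234)
    simpa using this
  filter_upwards [ht.eventually (gt_mem_nhds one_pos), eventually_im_pos hz] with z' h1 h2
  refine ((h.controlled hz hzP hp hr).norm_sub_le (x' := m z') (z' := z') (a' := a) (S' := S)
    hp3 (h.norm_le_of_le hz hp hr) (fun y => (h.norm_S_le y).trans (by gcongr)) (h.w_mul h2)
    h1.le).trans_eq ?_
  simp [norm_smul]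

/-- The part of the upper half-plane in a ball. -/
def halfBall (P : ℝ) : Set ℂ := {z | 0 < z.im ∧ ‖z‖ ≤ P}

lemma convex_halfBall (P : ℝ) : Convex ℝ (halfBall P) := by
  have h1 : Convex ℝ {z : ℂ | 0 < z.im} := convex_halfSpace_im_gt 0
  have h2 : Convex ℝ (Metric.closedBall (0 : ℂ) P) := convex_closedBall 0 P
  have : halfBall P = {z : ℂ | 0 < z.im} ∩ Metric.closedBall (0 : ℂ) P := by
    ext z; simp [halfBall]
  rw [this]; exact h1.inter h2

lemma Sys.continuousOn (h : Sys φ P c₁ c₂ a S m v) {Ω : Set ℂ} (hΩ : ∀ z ∈ Ω, 0 < z.im) :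
    ContinuousOn m Ω := fun z hz => (h.continuousAt (hΩ z hz)).continuousWithinAt

lemma Sys.norm_sub_le_of_le (h : Sys φ P c₁ c₂ a S m v) {Ω : Set ℂ} (hΩ : Convex ℝ Ω)
    (hΩP : Ω ⊆ halfBall P) {p : ℝ} (hp : P ≤ p) (hr : ∀ z ∈ Ω, p⁻¹ ≤ (φ.tr (m z)).im) {z z' : ℂ}
    (hz : z ∈ Ω) (hz' : z' ∈ Ω) : ‖m z' - m z‖ ≤ p ^ 236 * ‖z' - z‖ :=
  norm_sub_le_of_locally_lipschitz hΩ (h.continuousOn fun _ hz => (hΩP hz).1)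
    (fun z hz => nhdsWithin_le_nhds
      (h.eventually_norm_sub_le (hΩP hz).1 (hΩP hz).2 hp (hr z hz))) hz hz'

/-- The Hölder constant of the harmonic extension. -/
def holderConst (P : ℝ) : ℝ := 237 * 2 ^ 236 * P ^ 472

lemma abs_sub_tr_im_le (φ : TracialState A) (x y : A) :
    |(φ.tr x).im - (φ.tr y).im| ≤ ‖x - y‖ := by
  rw [← Complex.sub_im, ← map_sub]
  exact (Complex.abs_im_le_norm _).trans (norm_tr_le φ _)

lemma abs_sub_pow_le_abs_pow_sub {x y : ℝ} (hx : 0 ≤ x) (hy : 0 ≤ y) {n : ℕ} (hn : n ≠ 0) :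
    |x - y| ^ n ≤ |x ^ n - y ^ n| := by
  wlog hxy : y ≤ x generalizing x y
  · rw [abs_sub_comm, abs_sub_comm (x ^ n)]
    exact this hy hx (le_of_not_ge hxy)
  have h1 := pow_add_pow_le (sub_nonneg.2 hxy) hy hn
  rw [sub_add_cancel] at h1
  rw [abs_of_nonneg (sub_nonneg.2 hxy)]
  exact le_trans (by linarith) (le_abs_self _)

/-- The harmonic extension is uniformly Hölder continuous on bounded sets. -/
lemma Sys.abs_sub_pow_le (h : Sys φ P c₁ c₂ a S m v) {z z' : ℂ} (hz : z ∈ halfBall P)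
    (hz' : z' ∈ halfBall P) :
    |(φ.tr (m z')).im - (φ.tr (m z)).im| ^ 237 ≤ holderConst P * ‖z' - z‖ := by
  have hP := h.P_pos
  refine (abs_sub_pow_le_abs_pow_sub (h.tr_im_pos hz'.1).le (h.tr_im_pos hz.1).le
    (by norm_num)).trans ?_
  have hcont : ContinuousOn (fun z => (φ.tr (m z)).im ^ 237) (halfBall P) :=
    (Complex.continuous_im.comp_continuousOn
      (φ.cont.comp_continuousOn (h.continuousOn fun _ hz => hz.1))).pow _
  refine norm_sub_le_of_locally_lipschitz (convex_halfBall P) hcont (fun y hy => ?_) hz hz'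
  have hr := h.tr_im_pos hy.1
  have hrP := h.tr_im_le hy.1
  set r := (φ.tr (m y)).im with hrdef
  set p := P ^ 2 / r with hpdef
  have hp : P ≤ p := by rw [hpdef, le_div_iff₀ hr]; nlinarith
  have hpr : p⁻¹ ≤ r := by
    rw [hpdef, inv_div, div_le_iff₀ (by positivity)]
    have := h.three_le
    have : 1 ≤ P ^ 2 := by nlinarith
    nlinarith
  have hcr : ContinuousAt (fun z => (φ.tr (m z)).im) y :=
    Complex.continuous_im.continuousAt.comp (φ.cont.continuousAt.comp (h.continuousAt hy.1))
  have ev2 : ∀ᶠ z in nhds y, (φ.tr (m z)).im < 2 * r :=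
    hcr.eventually (gt_mem_nhds (by linarith))
  refine nhdsWithin_le_nhds ?_
  filter_upwards [h.eventually_norm_sub_le hy.1 hy.2 hp hpr, ev2, eventually_im_pos hy.1]
    with z h1 h2 h3
  have h4 := (abs_sub_tr_im_le φ _ _).trans h1
  rw [← hrdef] at h4
  rw [Real.norm_eq_abs]
  refine (abs_pow_sub_pow_le _ _ _).trans ?_
  rw [abs_of_pos (h.tr_im_pos h3), abs_of_pos hr]
  have hmax : max (φ.tr (m z)).im r ≤ 2 * r := max_le h2.le (by linarith)
  have hmax0 : 0 ≤ max (φ.tr (m z)).im r := le_max_of_le_right hr.le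
  calc |(φ.tr (m z)).im - r| * ((237 : ℕ) : ℝ) * max (φ.tr (m z)).im r ^ (237 - 1)
      ≤ (p ^ 236 * ‖z - y‖) * ((237 : ℕ) : ℝ) * (2 * r) ^ 236 :=
        mul_le_mul (mul_le_mul_of_nonneg_right h4 (Nat.cast_nonneg _))
          (pow_le_pow_left₀ hmax0 hmax _) (pow_nonneg hmax0 _)
          (mul_nonneg ((abs_nonneg _).trans h4) (Nat.cast_nonneg _))
    _ = 237 * 2 ^ 236 * (p * r) ^ 236 * ‖z - y‖ := by
        rw [mul_pow, mul_pow]; push_cast; ring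
    _ = _ := by
        rw [hpdef, div_mul_cancel₀ _ hr.ne', ← pow_mul]; rfl

end Sys

lemma lt_of_continuousOn_of_bootstrap {g : ℝ → ℝ} {α β κ : ℝ}
    (hg : ContinuousOn g (Set.Icc α β)) (hβ : g β < κ)
    (h : ∀ s ∈ Set.Icc α β, g s ≤ κ → g s < κ) {s : ℝ} (hs : s ∈ Set.Icc α β) : g s < κ := by
  by_contra! hlt
  obtain ⟨u, hu, hgu⟩ := intermediate_value_Icc' hs.2
    (hg.mono (Set.Icc_subset_Icc_left hs.1)) (show κ ∈ Set.Icc (g β) (g s) from ⟨hβ.le, hlt⟩)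
  exact (h u ⟨hs.1.trans hu.1, hu.2⟩ hgu.le).ne hgu

lemma norm_mk_le (t η : ℝ) : ‖(⟨t, η⟩ : ℂ)‖ ≤ |t| + |η| :=
  Complex.norm_le_abs_re_add_abs_im _

lemma continuous_mk (t : ℝ) : Continuous fun η : ℝ => (⟨t, η⟩ : ℂ) := by
  have : (fun η : ℝ => (⟨t, η⟩ : ℂ)) = fun η : ℝ => (t : ℂ) + η * Complex.I := by
    ext η; exact Complex.mk_eq_add_mul_I t η
  rw [this]; fun_prop

lemma tendsto_mk (t : ℝ) :
    Filter.Tendsto (fun η : ℝ => (⟨t, η⟩ : ℂ)) (nhdsWithin 0 (Set.Ioi 0)) (nhds (t : ℂ)) :=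
  ((continuous_mk t).tendsto 0).mono_left nhdsWithin_le_nhds

lemma eventually_mk_mem_halfBall {t P : ℝ} (ht : |t| < P) :
    ∀ᶠ η in nhdsWithin (0 : ℝ) (Set.Ioi 0), (⟨t, η⟩ : ℂ) ∈ halfBall P := by
  have h1 : ∀ᶠ η in nhdsWithin (0 : ℝ) (Set.Ioi 0), ‖(⟨t, η⟩ : ℂ)‖ < P :=
    (tendsto_mk t).norm.eventually (gt_mem_nhds (by simpa using ht))
  filter_upwards [h1, self_mem_nhdsWithin] with η h1 h2
  exact ⟨h2, h1.le⟩

/-- The boundary value of `Im ⟨m⟩` on the real line. -/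
def bdry (φ : TracialState A) (m : ℂ → A) (t : ℝ) : ℝ :=
  Filter.limUnder (nhdsWithin 0 (Set.Ioi 0)) fun η : ℝ => (φ.tr (m ⟨t, η⟩)).im

section Sys

variable {φ : TracialState A} {P c₁ c₂ : ℝ} {a : A} {S : A →L[ℂ] A} {m : ℂ → A}
  {v : OpMeasure A φ} {a' : A} {S' : A →L[ℂ] A} {m' : ℂ → A} {v' : OpMeasure A φ}

lemma holderConst_pos (hP : 0 < P) : 0 < holderConst P := by
  unfold holderConst; positivity

lemma Sys.tendsto_bdry (h : Sys φ P c₁ c₂ a S m v) (t : ℝ) :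
    Filter.Tendsto (fun η : ℝ => (φ.tr (m ⟨t, η⟩)).im) (nhdsWithin 0 (Set.Ioi 0))
      (nhds (bdry φ m t)) := by
  apply tendsto_nhds_limUnder
  rw [← cauchy_map_iff_exists_tendsto, Metric.cauchy_iff]
  refine ⟨inferInstance, fun ε hε => ?_⟩
  set Q := P + |t| with hQ
  have hP := h.P_pos
  have hQ' := h.mono (Q := Q) (by rw [hQ]; linarith [abs_nonneg t])
  have hL := holderConst_pos hQ'.P_pos
  have h1 := eventually_mk_mem_halfBall (t := t) (P := Q) (by rw [hQ]; linarith)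
  have h2 : Set.Ioo 0 (ε ^ 237 / holderConst Q) ∈ nhdsWithin (0 : ℝ) (Set.Ioi 0) :=
    Ioo_mem_nhdsGT (by positivity)
  refine ⟨_, Filter.image_mem_map (Filter.inter_mem h1 h2), ?_⟩
  rintro _ ⟨η, ⟨hη, hη1⟩, rfl⟩ _ ⟨η', ⟨hη', hη1'⟩, rfl⟩
  rw [Real.dist_eq]
  have h3 := hQ'.abs_sub_pow_le hη' hη
  refine lt_of_pow_lt_pow_left₀ 237 hε.le (h3.trans_lt ?_)
  rw [mul_comm, ← lt_div_iff₀ hL]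
  have e : (⟨t, η⟩ : ℂ) - ⟨t, η'⟩ = ⟨0, η - η'⟩ := by
    apply Complex.ext <;> simp
  rw [e]
  refine (norm_mk_le _ _).trans_lt ?_
  rw [abs_zero, zero_add, abs_lt]
  constructor <;> linarith [hη1.1, hη1.2, hη1'.1, hη1'.2]

lemma Sys.bdry_nonneg (h : Sys φ P c₁ c₂ a S m v) (t : ℝ) : 0 ≤ bdry φ m t := by
  refine ge_of_tendsto (h.tendsto_bdry t) ?_
  filter_upwards [self_mem_nhdsWithin] with η hη
  exact (h.tr_im_pos (z := ⟨t, η⟩) hη).le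

lemma Sys.bdry_le (h : Sys φ P c₁ c₂ a S m v) (t : ℝ) : bdry φ m t ≤ P := by
  refine le_of_tendsto (h.tendsto_bdry t) ?_
  filter_upwards [self_mem_nhdsWithin] with η hη
  exact h.tr_im_le (z := ⟨t, η⟩) hη

lemma Sys.abs_tr_sub_bdry_pow_le (h : Sys φ P c₁ c₂ a S m v) {z : ℂ} (hz : z ∈ halfBall P) {t : ℝ}
    (ht : |t| < P) :
    |(φ.tr (m z)).im - bdry φ m t| ^ 237 ≤ holderConst P * ‖z - t‖ := by
  refine le_of_tendsto_of_tendsto ((tendsto_const_nhds.sub (h.tendsto_bdry t)).abs.pow 237)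
    ((tendsto_const_nhds.sub (tendsto_mk t)).norm.const_mul (holderConst P)) ?_
  filter_upwards [eventually_mk_mem_halfBall ht] with η hη
  exact h.abs_sub_pow_le hη hz

lemma Sys.abs_bdry_sub_bdry_pow_le (h : Sys φ P c₁ c₂ a S m v) {t t' : ℝ} (ht : |t| < P)
    (ht' : |t'| < P) :
    |bdry φ m t - bdry φ m t'| ^ 237 ≤ holderConst P * |t - t'| := by
  have := le_of_tendsto_of_tendsto (((h.tendsto_bdry t).sub_const (bdry φ m t')).abs.pow 237)
    (((tendsto_mk t).sub_const (t' : ℂ)).norm.const_mul (holderConst P)) (by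
      filter_upwards [eventually_mk_mem_halfBall ht] with η hη
      exact h.abs_tr_sub_bdry_pow_le hη ht')
  rwa [← Complex.ofReal_sub, Complex.norm_real, Real.norm_eq_abs] at this

lemma Sys.continuous_bdry (h : Sys φ P c₁ c₂ a S m v) : Continuous (bdry φ m) := by
  rw [continuous_iff_continuousAt]
  intro t
  have hP := h.P_pos
  set Q := P + |t| with hQ
  have hQ' := h.mono (Q := Q) (by rw [hQ]; linarith [abs_nonneg t])
  have ht : |t| < Q := by rw [hQ]; linarith
  have hL := holderConst_pos hQ'.P_pos
  rw [Metric.continuousAt_iff]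
  intro ε hε
  refine ⟨min P (ε ^ 237 / holderConst Q), by positivity, fun {t'} hd => ?_⟩
  rw [Real.dist_eq] at hd ⊢
  have ht' : |t'| < Q := by
    have h1 := abs_sub_abs_le_abs_sub t' t
    have h2 := hd.trans_le (min_le_left _ _)
    rw [hQ]; linarith
  refine lt_of_pow_lt_pow_left₀ 237 hε.le ((hQ'.abs_bdry_sub_bdry_pow_le ht' ht).trans_lt ?_)
  rw [mul_comm, ← lt_div_iff₀ hL]
  exact hd.trans_le (min_le_right _ _)

lemma Sys.continuousOn_vertical (h : Sys φ P c₁ c₂ a S m v) (t : ℝ) {α β : ℝ} (hα : 0 < α) :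
    ContinuousOn (fun s : ℝ => m ⟨t, s⟩) (Set.Icc α β) := fun s hs =>
  ((h.continuousAt (z := ⟨t, s⟩) (hα.trans_le hs.1)).comp
    (continuous_mk t).continuousAt).continuousWithinAt

/-- Away from a bounded interval the density of states vanishes. -/
lemma Sys.bdry_eq_zero (h : Sys φ P c₁ c₂ a S m v) {t : ℝ} (ht : 4 * P ≤ |t|) :
    bdry φ m t = 0 := by
  have := φ.nontrivial
  have hP := h.P_pos
  have hP3 := h.three_le
  have key : ∀ s : ℝ, 0 < s → ‖m ⟨t, s⟩‖ ≤ 1 → ‖m ⟨t, s⟩‖ ≤ (2 * P)⁻¹ := by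
    intro s hs h1
    set x := m ⟨t, s⟩ with hx
    have e : (⟨t, s⟩ : ℂ) • x = -1 + x * a - x * S x := by
      have := h.mul_w (z := ⟨t, s⟩) hs
      rw [← hx, dysonW, mul_add, mul_sub, mul_smul_comm, mul_one] at this
      rw [← this]; abel
    have h2 : ‖(⟨t, s⟩ : ℂ) • x‖ ≤ 1 + ‖x‖ * P + ‖x‖ * (P * ‖x‖) := by
      rw [e]
      refine (_root_.norm_sub_le _ _).trans (add_le_add ((norm_add_le _ _).trans ?_) ?_)
      · rw [norm_neg, CStarRing.norm_one]
        gcongr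
        exact (norm_mul_le _ _).trans (by gcongr; exact h.norm_a)
      · exact (norm_mul_le _ _).trans (by gcongr; exact h.norm_S_le x)
    rw [norm_smul] at h2
    have h3 : 4 * P ≤ ‖(⟨t, s⟩ : ℂ)‖ := ht.trans (Complex.abs_re_le_norm ⟨t, s⟩)
    have h0 := norm_nonneg x
    have h4 : 4 * P * ‖x‖ ≤ ‖(⟨t, s⟩ : ℂ)‖ * ‖x‖ := by gcongr
    have h5 : ‖x‖ * (P * ‖x‖) ≤ ‖x‖ * (P * 1) := by gcongr
    rw [← one_div, le_div_iff₀ (by positivity)]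
    linarith
  have hlt : (2 * P)⁻¹ < 1 := inv_lt_one_of_one_lt₀ (by linarith)
  have small : ∀ s : ℝ, 0 < s → s ≤ 1 → ‖m ⟨t, s⟩‖ ≤ (2 * P)⁻¹ := by
    intro s hs hs1
    refine key s hs (le_of_lt ?_)
    refine lt_of_continuousOn_of_bootstrap (g := fun s => ‖m ⟨t, s⟩‖) (α := s) (β := 1)
      (h.continuousOn_vertical t hs).norm ?_ ?_ ⟨le_rfl, hs1⟩
    · refine (key 1 one_pos ?_).trans_lt hlt
      simpa using h.norm_le_inv_im (z := ⟨t, 1⟩) one_pos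
    · intro u hu h1
      exact (key u (hs.trans_le hu.1) h1).trans_lt hlt
  refine le_antisymm ?_ (h.bdry_nonneg t)
  have hlim : Filter.Tendsto (fun s : ℝ => 2 * s) (nhdsWithin 0 (Set.Ioi 0)) (nhds 0) := by
    have : Filter.Tendsto (fun s : ℝ => 2 * s) (nhds 0) (nhds (2 * 0)) :=
      (continuous_const.mul continuous_id).tendsto 0
    rw [mul_zero] at this
    exact this.mono_left nhdsWithin_le_nhds
  refine le_of_tendsto_of_tendsto (h.tendsto_bdry t) hlim ?_
  filter_upwards [Ioo_mem_nhdsGT one_pos] with s hs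
  have hs0 : 0 < (⟨t, s⟩ : ℂ).im := hs.1
  set x := m ⟨t, s⟩ with hx
  set r := (φ.tr x).im with hr
  have hr0 : 0 < r := h.tr_im_pos hs0
  have h1 : imA (dysonW a S ⟨t, s⟩ x) ≤ (s + P * r) • (1 : A) := by
    rw [imA_dysonW h.sa h.pos, add_smul]
    refine add_le_add le_rfl ((h.flat.ge (h.imA_nonneg hs0)).trans (smul_one_mono ?_))
    rw [φ.tr_imA_re]
    exact mul_le_mul_of_nonneg_right h.c₂_le hr0.le
  have h2 := star_left_conjugate_le_conjugate h1 x
  rw [(conj_imA_eq (h.mul_w hs0) (h.w_mul hs0)).2, mul_smul_comm, mul_one, smul_mul_assoc] at h2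
  have hn := small s hs.1 hs.2.le
  have h3 : star x * x ≤ ((2 * P)⁻¹ ^ 2) • (1 : A) :=
    (star_mul_self_le_smul_one x).trans (smul_one_mono (by gcongr))
  have h4 := h2.trans (smul_le_smul_of_nonneg_left h3
    (by have := hs.1; positivity : 0 ≤ s + P * r))
  rw [smul_smul] at h4
  have h5 := φ.tr_re_mono h4
  rw [φ.tr_real_smul_one, Complex.ofReal_re, φ.tr_imA_re, ← hr, inv_pow, ← div_eq_mul_inv,
    le_div_iff₀ (by positivity)] at h5
  have := hs.1
  show r ≤ 2 * s
  have h7 : P ≤ P ^ 2 := by nlinarith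
  have h8 : r * P ≤ r * P ^ 2 := by gcongr
  have h9 : r * 3 ≤ r * P := by gcongr
  nlinarith

lemma norm_perturbation_le (a a' x : A) (S S' : A →L[ℂ] A) (z : ℂ) {p : ℝ} (hp : 1 ≤ p)
    (hx : ‖x‖ ≤ p) :
    ‖(z - z) • (1 : A) - (a' - a) + (S' - S) x‖ ≤ (‖a - a'‖ + ‖S - S'‖) * p := by
  rw [sub_self, zero_smul, zero_sub, neg_sub]
  refine (norm_add_le _ _).trans ?_
  rw [add_mul]
  refine add_le_add (le_mul_of_one_le_right (norm_nonneg _) hp) ?_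
  refine (ContinuousLinearMap.le_opNorm _ _).trans ?_
  rw [norm_sub_rev S' S]
  gcongr

/-- Comparison of the solutions for two data pairs away from the real line. -/
lemma Sys.norm_sub_le_of_data (h : Sys φ P c₁ c₂ a S m v) (h' : Sys φ P c₁ c₂ a' S' m' v') {t : ℝ}
    (ht : |t| ≤ 7 * P) {η : ℝ} (hη : 0 < η) (hη1 : η ≤ 1)
    (hδ : (‖a - a'‖ + ‖S - S'‖) * ((10 * P) ^ 4 / η ^ 3) ^ 472 ≤ 1) :
    ‖m' ⟨t, η⟩ - m ⟨t, η⟩‖ ≤ η := by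
  have hP := h.P_pos
  have hP3 := h.three_le
  set Q := 10 * P with hQ
  have hQ1 : 1 ≤ Q := by linarith
  have hh := h.mono (Q := Q) (by linarith)
  set p := Q ^ 4 / η ^ 3 with hp
  set δ := ‖a - a'‖ + ‖S - S'‖ with hδd
  have hδ0 : 0 ≤ δ := by positivity
  have hQp : Q ≤ p := by
    rw [hp, le_div_iff₀ (by positivity)]
    have h1 : η ^ 3 ≤ 1 := pow_le_one₀ hη.le hη1
    have h2 : Q ^ 1 ≤ Q ^ 4 := pow_le_pow_right₀ hQ1 (by norm_num)
    nlinarith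
  have hp3 : 3 ≤ p := hh.three_le.trans hQp
  have hp1 : 1 ≤ p := by linarith
  have hp0 : 0 < p := by linarith
  have hpη : η⁻¹ ≤ p := by
    rw [hp, le_div_iff₀ (by positivity)]
    have : η⁻¹ * η ^ 3 = η ^ 2 := by field_simp
    rw [this]
    exact (pow_le_one₀ hη.le hη1).trans (one_le_pow₀ hQ1)
  have hm : ∀ s, η ≤ s → ‖m' ⟨t, s⟩‖ ≤ p := fun s hs =>
    ((h'.norm_le_inv_im (z := ⟨t, s⟩) (hη.trans_le hs)).trans (inv_anti₀ hη hs)).trans hpη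
  have final : ∀ s, ‖m' ⟨t, s⟩ - m ⟨t, s⟩‖ ≤ p ^ 236 * (δ * p) →
      ‖m' ⟨t, s⟩ - m ⟨t, s⟩‖ * p ^ 234 < 1 := by
    intro s hs
    calc ‖m' ⟨t, s⟩ - m ⟨t, s⟩‖ * p ^ 234 ≤ p ^ 236 * (δ * p) * p ^ 234 := by gcongr
      _ = (δ * p ^ 472) * p⁻¹ := by field_simp
      _ ≤ 1 * p⁻¹ := by gcongr
      _ < 1 := by rw [one_mul]; exact inv_lt_one_of_one_lt₀ (by linarith)
  have hlt : ‖m' ⟨t, η⟩ - m ⟨t, η⟩‖ * p ^ 234 < 1 := by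
    refine lt_of_continuousOn_of_bootstrap (g := fun s => ‖m' ⟨t, s⟩ - m ⟨t, s⟩‖ * p ^ 234)
      (α := η) (β := 2 * P)
      (((h'.continuousOn_vertical t hη).sub (h.continuousOn_vertical t hη)).norm.mul
        continuousOn_const) (final _ ?_) ?_ ⟨le_rfl, by linarith⟩
    · have hz : 0 < (⟨t, 2 * P⟩ : ℂ).im := by show 0 < 2 * P; positivity
      have h1 := dyson_sub_eq (h.mul_w hz) (h'.w_mul hz)
      have h2 : ‖m ⟨t, 2 * P⟩‖ ≤ (2 * P)⁻¹ := h.norm_le_inv_im hz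
      have h3 : ‖m' ⟨t, 2 * P⟩‖ ≤ (2 * P)⁻¹ := h'.norm_le_inv_im hz
      have hD := norm_perturbation_le a a' (m' ⟨t, 2 * P⟩) S S' ⟨t, 2 * P⟩ hp1
        (hm _ (by linarith))
      set D := ((⟨t, 2 * P⟩ : ℂ) - ⟨t, 2 * P⟩) • (1 : A) - (a' - a) + (S' - S) (m' ⟨t, 2 * P⟩)
      set x := m ⟨t, 2 * P⟩
      set x' := m' ⟨t, 2 * P⟩
      have hle1 : (2 * P)⁻¹ ≤ 1 := inv_le_one_of_one_le₀ (by linarith)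
      have h4 : ‖x * D * x'‖ ≤ 1 * (δ * p) * 1 :=
        (norm_mul_le _ _).trans (by
          gcongr
          · exact (norm_mul_le _ _).trans (by gcongr; exact h2.trans hle1)
          · exact h3.trans hle1)
      have h5 : ‖x * S (x' - x) * x'‖ ≤ (2 * P)⁻¹ * (P * ‖x' - x‖) * 1 :=
        (norm_mul_le _ _).trans (by
          gcongr
          · exact (norm_mul_le _ _).trans (by gcongr; exact h.norm_S_le _)
          · exact h3.trans hle1)
      have e : (2 * P)⁻¹ * (P * ‖x' - x‖) * 1 = ‖x' - x‖ / 2 := by field_simp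
      rw [e] at h5
      have h6 : ‖x' - x‖ ≤ 1 * (δ * p) * 1 + ‖x' - x‖ / 2 := by
        nth_rewrite 1 [h1]
        exact (norm_add_le _ _).trans (add_le_add h4 h5)
      have h7 : 2 ≤ p ^ 236 := by
        have : p ^ 1 ≤ p ^ 236 := pow_le_pow_right₀ hp1 (by norm_num)
        linarith
      have h8 : 0 ≤ δ * p := by positivity
      nlinarith
    · intro s hs hle
      have hs0 : 0 < s := hη.trans_le hs.1
      have hsQ : ‖(⟨t, s⟩ : ℂ)‖ ≤ Q := by
        refine (norm_mk_le _ _).trans ?_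
        rw [abs_of_pos hs0]; linarith [hs.2]
      have hr : p⁻¹ ≤ (φ.tr (m ⟨t, s⟩)).im := by
        rw [hp, inv_div]; exact hh.le_tr_im hη hη1 hs.1 hsQ
      refine final s (((hh.controlled (z := ⟨t, s⟩) hs0 hsQ hQp hr).norm_sub_le
        (x' := m' ⟨t, s⟩) (z' := ⟨t, s⟩) (a' := a') (S' := S') hp3
        (hh.norm_le_of_le (z := ⟨t, s⟩) hs0 hQp hr)
        (fun y => (hh.norm_S_le y).trans (by gcongr)) (h'.w_mul (z := ⟨t, s⟩) hs0) hle).trans ?_)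
      gcongr
      exact norm_perturbation_le a a' _ S S' _ hp1 (hm s hs.1)
  have h1 : p ≤ p ^ 234 := le_self_pow₀ hp1 (by norm_num)
  have h2 : ‖m' ⟨t, η⟩ - m ⟨t, η⟩‖ * η⁻¹ ≤ 1 := by
    refine le_trans ?_ hlt.le
    gcongr
    exact hpη.trans h1
  rwa [← div_eq_mul_inv, div_le_one hη] at h2

end Sys

section Poisson

/-- The Poisson kernel of the upper half-plane, without the normalising factor. -/
def poisson (η x : ℝ) : ℝ := η / (x ^ 2 + η ^ 2)

lemma im_inv_sub_mk (s t η : ℝ) : (((s : ℂ) - ⟨t, η⟩)⁻¹).im = poisson η (s - t) := by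
  rw [Complex.inv_im, Complex.normSq_apply, poisson]
  simp only [Complex.sub_re, Complex.sub_im, Complex.ofReal_re, Complex.ofReal_im]
  ring

lemma poisson_nonneg {η : ℝ} (hη : 0 ≤ η) (x : ℝ) : 0 ≤ poisson η x := by
  unfold poisson; positivity

lemma poisson_le {η : ℝ} (hη : 0 < η) (x : ℝ) : poisson η x ≤ η⁻¹ := by
  unfold poisson
  rw [div_le_iff₀ (by positivity), mul_add]
  have : η⁻¹ * η ^ 2 = η := by field_simp
  rw [this]
  have : 0 ≤ η⁻¹ * x ^ 2 := by positivity
  linarith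

lemma continuous_poisson {η : ℝ} (hη : 0 < η) : Continuous (poisson η) := by
  unfold poisson
  exact continuous_const.div (by fun_prop) fun x => by positivity

lemma integral_poisson_mul {η : ℝ} (hη : 0 < η) (g : ℝ → ℝ) (s : ℝ) :
    ∫ t, poisson η (s - t) * g t = ∫ x, (1 + x ^ 2)⁻¹ * g (s + η * x) := by
  rw [← integral_add_left_eq_self (fun t => poisson η (s - t) * g t) s]
  have := Measure.integral_comp_mul_left (fun y => poisson η (s - (s + y)) * g (s + y)) η
  rw [abs_of_pos (inv_pos.2 hη), smul_eq_mul, eq_inv_mul_iff_mul_eq₀ hη.ne',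
    ← integral_const_mul] at this
  rw [← this]
  congr 1; ext x
  rw [← mul_assoc]
  congr 1
  unfold poisson
  field_simp
  ring

variable {g : ℝ → ℝ} {B : ℝ}

lemma norm_poisson_integrand_le (hB : ∀ t, |g t| ≤ B) (s η x : ℝ) :
    ‖(1 + x ^ 2)⁻¹ * g (s + η * x)‖ ≤ (1 + x ^ 2)⁻¹ * B := by
  rw [norm_mul, Real.norm_of_nonneg (by positivity)]
  exact mul_le_mul_of_nonneg_left (hB _) (by positivity)

lemma continuous_inv_one_add_sq : Continuous fun x : ℝ => (1 + x ^ 2)⁻¹ :=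
  Continuous.inv₀ (by fun_prop) fun x => by positivity

lemma tendsto_integral_poisson (hg : Continuous g) (hB : ∀ t, |g t| ≤ B) (s : ℝ) :
    Filter.Tendsto (fun η : ℝ => ∫ x, (1 + x ^ 2)⁻¹ * g (s + η * x))
      (nhdsWithin 0 (Set.Ioi 0)) (nhds (Real.pi * g s)) := by
  have : Real.pi * g s = ∫ x : ℝ, (1 + x ^ 2)⁻¹ * g s := by
    rw [integral_mul_const, integral_univ_inv_one_add_sq]
  rw [this]
  refine tendsto_integral_filter_of_dominated_convergence (fun x => (1 + x ^ 2)⁻¹ * B)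
    (Filter.Eventually.of_forall fun η => ?_)
    (Filter.Eventually.of_forall fun η => Filter.Eventually.of_forall
      (norm_poisson_integrand_le hB s η)) (integrable_inv_one_add_sq.mul_const B)
    (Filter.Eventually.of_forall fun x => ?_)
  · exact (continuous_inv_one_add_sq.mul (by fun_prop)).aestronglyMeasurable
  · have hc : Continuous fun η : ℝ => (1 + x ^ 2)⁻¹ * g (s + η * x) := by fun_prop
    have := hc.tendsto 0
    rw [zero_mul, add_zero] at this
    exact this.mono_left nhdsWithin_le_nhds

/-- Weak convergence of the Poisson regularisation of a finite measure. -/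
lemma tendsto_integral_poisson_measure (μ : Measure ℝ) [IsFiniteMeasure μ] (hg : Continuous g)
    (hgc : HasCompactSupport g) :
    Filter.Tendsto (fun η : ℝ => ∫ t, (∫ s, poisson η (s - t) ∂μ) * g t)
      (nhdsWithin 0 (Set.Ioi 0)) (nhds (Real.pi * ∫ s, g s ∂μ)) := by
  obtain ⟨B, hB⟩ := hg.bounded_above_of_compact_support hgc
  have hgi : Integrable g := hg.integrable_of_hasCompactSupport hgc
  have key : ∀ η : ℝ, 0 < η → ∫ t, (∫ s, poisson η (s - t) ∂μ) * g t
      = ∫ s, (∫ x, (1 + x ^ 2)⁻¹ * g (s + η * x)) ∂μ := by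
    intro η hη
    simp_rw [← integral_poisson_mul hη, ← integral_mul_const]
    refine integral_integral_swap ?_
    refine (hgi.comp_fst μ).bdd_mul (c := η⁻¹) (f := fun q : ℝ × ℝ => poisson η (q.2 - q.1)) ?_ ?_
    · exact ((continuous_poisson hη).comp (by fun_prop)).aestronglyMeasurable
    · refine Filter.Eventually.of_forall fun q => ?_
      rw [Real.norm_of_nonneg (poisson_nonneg hη.le _)]
      exact poisson_le hη _
  rw [← integral_const_mul]
  have : Filter.Tendsto (fun η : ℝ => ∫ s, (∫ x, (1 + x ^ 2)⁻¹ * g (s + η * x)) ∂μ)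
      (nhdsWithin 0 (Set.Ioi 0)) (nhds (∫ s, Real.pi * g s ∂μ)) := by
    refine tendsto_integral_filter_of_dominated_convergence (fun _ => Real.pi * B)
      (Filter.Eventually.of_forall fun η => ?_)
      (Filter.Eventually.of_forall fun η => Filter.Eventually.of_forall fun s => ?_)
      (integrable_const _) (Filter.Eventually.of_forall fun s => tendsto_integral_poisson hg hB s)
    · refine Continuous.aestronglyMeasurable ?_
      refine continuous_of_dominated (bound := fun x => (1 + x ^ 2)⁻¹ * B) (fun s => ?_)
        (fun s => Filter.Eventually.of_forall (norm_poisson_integrand_le hB s η))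
        (integrable_inv_one_add_sq.mul_const B) (Filter.Eventually.of_forall fun x => ?_)
      · exact (continuous_inv_one_add_sq.mul (by fun_prop)).aestronglyMeasurable
      · fun_prop
    · refine (norm_integral_le_of_norm_le (integrable_inv_one_add_sq.mul_const B)
        (Filter.Eventually.of_forall (norm_poisson_integrand_le hB s η))).trans_eq ?_
      rw [integral_mul_const, integral_univ_inv_one_add_sq]
  refine this.congr' ?_
  filter_upwards [self_mem_nhdsWithin] with η hη
  exact (key η hη).symm

end Poisson

section Sys

variable {φ : TracialState A} {P c₁ c₂ : ℝ} {a : A} {S : A →L[ℂ] A} {m : ℂ → A}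
  {v : OpMeasure A φ}

lemma Sys.tr_im_eq_integral (h : Sys φ P c₁ c₂ a S m v) {t η : ℝ} (hη : 0 < η) :
    (φ.tr (m ⟨t, η⟩)).im = ∫ s, poisson η (s - t) ∂v.dos := by
  have := v.scalarFin 1
  have h1 := h.rep ⟨t, η⟩ hη 1
  rw [star_one, one_mul, mul_one] at h1
  rw [h1]
  have h2 := Complex.imCLM.integral_comp_comm
    (integrable_inv_sub (z := ⟨t, η⟩) hη (v.scalar 1))
  simp only [Complex.imCLM_apply, im_inv_sub_mk] at h2
  exact h2.symm

/-- Stieltjes inversion: the density of states is given by the boundary values. -/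
lemma Sys.dos_eq (h : Sys φ P c₁ c₂ a S m v) :
    v.dos = volume.withDensity fun t => ENNReal.ofReal (bdry φ m t / Real.pi) := by
  have hfin : IsFiniteMeasure v.dos := v.scalarFin 1
  have hc : Continuous fun t => bdry φ m t / Real.pi := h.continuous_bdry.div_const _
  have : IsLocallyFiniteMeasure
      (volume.withDensity fun t => ENNReal.ofReal (bdry φ m t / Real.pi)) :=
    IsLocallyFiniteMeasure.withDensity_ofReal hc
  refine Measure.ext_of_integral_eq_on_compactlySupported fun g => ?_
  rw [integral_withDensity_eq_integral_toReal_smul hc.measurable.ennreal_ofReal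
    (Filter.Eventually.of_forall fun _ => ENNReal.ofReal_lt_top)]
  have hg : Integrable g := g.continuous.integrable_of_hasCompactSupport g.hasCompactSupport
  have h1 := tendsto_integral_poisson_measure v.dos g.continuous g.hasCompactSupport
  have h2 : Filter.Tendsto (fun η : ℝ => ∫ t, (∫ s, poisson η (s - t) ∂v.dos) * g t)
      (nhdsWithin 0 (Set.Ioi 0)) (nhds (∫ t, bdry φ m t * g t)) := by
    have h3 : Filter.Tendsto (fun η : ℝ => ∫ t, (φ.tr (m ⟨t, η⟩)).im * g t)
        (nhdsWithin 0 (Set.Ioi 0)) (nhds (∫ t, bdry φ m t * g t)) := by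
      refine tendsto_integral_filter_of_dominated_convergence (fun t => P * |g t|) ?_ ?_
        (hg.abs.const_mul P)
        (Filter.Eventually.of_forall fun t => (h.tendsto_bdry t).mul_const _)
      · filter_upwards [self_mem_nhdsWithin] with η hη
        refine Continuous.aestronglyMeasurable (Continuous.mul ?_ g.continuous)
        refine Complex.continuous_im.comp (φ.cont.comp (continuous_iff_continuousAt.2 fun t => ?_))
        refine ContinuousAt.comp (f := fun t : ℝ => (⟨t, η⟩ : ℂ))
          (h.continuousAt (z := ⟨t, η⟩) hη) (Continuous.continuousAt ?_)
        have : (fun t : ℝ => (⟨t, η⟩ : ℂ)) = fun t : ℝ => (t : ℂ) + η * Complex.I := by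
          ext t; exact Complex.mk_eq_add_mul_I t η
        rw [this]; fun_prop
      · filter_upwards [self_mem_nhdsWithin] with η hη
        refine Filter.Eventually.of_forall fun t => ?_
        rw [norm_mul, Real.norm_of_nonneg (h.tr_im_pos (z := ⟨t, η⟩) hη).le, Real.norm_eq_abs]
        exact mul_le_mul_of_nonneg_right (h.tr_im_le (z := ⟨t, η⟩) hη) (abs_nonneg _)
    refine h3.congr' ?_
    filter_upwards [self_mem_nhdsWithin] with η hη
    congr 1; ext t
    rw [h.tr_im_eq_integral hη]
  have h4 := tendsto_nhds_unique h1 h2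
  have e : ∀ t, (ENNReal.ofReal (bdry φ m t / Real.pi)).toReal • g t
      = Real.pi⁻¹ * (bdry φ m t * g t) := by
    intro t
    rw [ENNReal.toReal_ofReal (div_nonneg (h.bdry_nonneg t) Real.pi_pos.le), smul_eq_mul]
    ring
  simp_rw [e]
  rw [integral_const_mul, ← h4, inv_mul_cancel_left₀ Real.pi_ne_zero]
  rfl

/-- A continuous density of the density of states is given by the boundary values. -/
lemma Sys.density_eq (h : Sys φ P c₁ c₂ a S m v) {f : ℝ → ℝ} (hf : Continuous f)
    (hf0 : ∀ t, 0 ≤ f t) (hd : v.dos = volume.withDensity fun t => ENNReal.ofReal (f t)) (t : ℝ) :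
    f t = bdry φ m t / Real.pi := by
  have hc : Continuous fun t => bdry φ m t / Real.pi := h.continuous_bdry.div_const _
  have h1 := h.dos_eq
  rw [hd, withDensity_eq_iff_of_sigmaFinite hf.measurable.ennreal_ofReal.aemeasurable
    hc.measurable.ennreal_ofReal.aemeasurable] at h1
  have h2 : f =ᵐ[volume] fun t => bdry φ m t / Real.pi := by
    filter_upwards [h1] with t ht
    exact (ENNReal.ofReal_eq_ofReal_iff (hf0 t)
      (div_nonneg (h.bdry_nonneg t) Real.pi_pos.le)).1 ht
  exact congrFun ((hf.ae_eq_iff_eq volume hc).1 h2) t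

end Sys

section Holder

variable {φ : TracialState A} {P c₁ c₂ : ℝ} {a : A} {S : A →L[ℂ] A} {m : ℂ → A}
  {v : OpMeasure A φ} {a' : A} {S' : A →L[ℂ] A} {m' : ℂ → A} {v' : OpMeasure A φ}

lemma le_rpow_of_pow_le {d x : ℝ} (hd : 0 ≤ d) (h : d ^ 237 ≤ x) : d ≤ x ^ (1 / 237 : ℝ) := by
  have h1 := Real.rpow_le_rpow (pow_nonneg hd 237) h (by norm_num : (0 : ℝ) ≤ 1 / 237)
  rwa [← Real.rpow_natCast, ← Real.rpow_mul hd, show ((237 : ℕ) : ℝ) * (1 / 237) = 1 by norm_num,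
    Real.rpow_one] at h1

/-- The constant in the joint Hölder estimate for the boundary values. -/
def jointConst (P : ℝ) : ℝ :=
  (3 * holderConst (10 * P) ^ (1 / 237 : ℝ) + 1 + P) * ((10 * P) ^ 1888) ^ (1 / 335592 : ℝ)

lemma jointConst_pos (hP : 0 < P) : 0 < jointConst P := by
  have := holderConst_pos (P := 10 * P) (by positivity)
  unfold jointConst
  have h1 : 0 < ((10 * P) ^ 1888) ^ (1 / 335592 : ℝ) :=
    Real.rpow_pos_of_pos (pow_pos (by positivity) _) _
  have h2 := Real.rpow_pos_of_pos this (1 / 237 : ℝ)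
  exact mul_pos (by linarith) h1

/-- Comparison of the boundary values at a mesoscopic scale `η`. -/
lemma Sys.abs_bdry_sub_le_scale (h : Sys φ P c₁ c₂ a S m v) (h' : Sys φ P c₁ c₂ a' S' m' v')
    {t t' : ℝ} (ht : |t| ≤ 7 * P) (htt : |t - t'| ≤ 1) {η : ℝ} (hη : 0 < η) (hη1 : η ≤ 1)
    (hδ : (‖a - a'‖ + ‖S - S'‖) * ((10 * P) ^ 4 / η ^ 3) ^ 472 ≤ 1) (htη : |t - t'| ≤ η) :
    |bdry φ m t - bdry φ m' t'| ≤ 3 * (holderConst (10 * P) * η) ^ (1 / 237 : ℝ) + η := by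
  have hP := h.P_pos
  have hP3 := h.three_le
  have hQ := h.mono (Q := 10 * P) (by linarith)
  have hQ' := h'.mono (Q := 10 * P) (by linarith)
  have hL := holderConst_pos hQ.P_pos
  have ht1 : |t| < 10 * P := by linarith
  have ht1' : |t'| < 10 * P := by
    have := abs_sub_abs_le_abs_sub t' t
    rw [abs_sub_comm t' t] at this
    linarith
  have hz : (⟨t, η⟩ : ℂ) ∈ halfBall (10 * P) :=
    ⟨hη, (norm_mk_le _ _).trans (by rw [abs_of_pos hη]; linarith)⟩
  have hd : ‖(⟨t, η⟩ : ℂ) - t‖ ≤ η := by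
    have : (⟨t, η⟩ : ℂ) - t = ⟨0, η⟩ := by apply Complex.ext <;> simp
    rw [this]
    exact (norm_mk_le _ _).trans (by rw [abs_zero, zero_add, abs_of_pos hη])
  have h1 := le_rpow_of_pow_le (abs_nonneg _) ((hQ.abs_tr_sub_bdry_pow_le hz ht1).trans
    (mul_le_mul_of_nonneg_left hd hL.le))
  have h2 := le_rpow_of_pow_le (abs_nonneg _) ((hQ'.abs_tr_sub_bdry_pow_le hz ht1).trans
    (mul_le_mul_of_nonneg_left hd hL.le))
  have h3 := le_rpow_of_pow_le (abs_nonneg _) ((hQ'.abs_bdry_sub_bdry_pow_le ht1 ht1').trans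
    (mul_le_mul_of_nonneg_left htη hL.le))
  have h4 := (abs_sub_tr_im_le φ (m' ⟨t, η⟩) (m ⟨t, η⟩)).trans
    (h.norm_sub_le_of_data h' ht hη hη1 hδ)
  rw [abs_le] at h1 h2 h3 h4 ⊢
  constructor <;> linarith [h1.1, h1.2, h2.1, h2.2, h3.1, h3.2, h4.1, h4.2]

lemma Sys.abs_bdry_sub_le_of_pos (h : Sys φ P c₁ c₂ a S m v) (h' : Sys φ P c₁ c₂ a' S' m' v')
    {t t' : ℝ} (htt : |t - t'| ≤ 1) {X : ℝ} (hX : 0 < X)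
    (hδ : ‖a - a'‖ + ‖S - S'‖ + |t - t'| ≤ X) :
    |bdry φ m t - bdry φ m' t'| ≤ jointConst P * X ^ (1 / 335592 : ℝ) := by
  have hP := h.P_pos
  have hP3 := h.three_le
  have hL := holderConst_pos (P := 10 * P) (by positivity)
  have hB : 0 < (10 * P) ^ 1888 := pow_pos (by positivity) _
  have hB1 : 1 ≤ (10 * P) ^ 1888 := one_le_pow₀ (by linarith)
  have hδ0 : 0 ≤ ‖a - a'‖ + ‖S - S'‖ := by positivity
  have hLr := Real.rpow_pos_of_pos hL (1 / 237 : ℝ)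
  set B := (10 * P) ^ 1888 with hBd
  set Y := B * X with hY
  have hY0 : 0 < Y := mul_pos hB hX
  have e : jointConst P * X ^ (1 / 335592 : ℝ) =
      (3 * holderConst (10 * P) ^ (1 / 237 : ℝ) + 1 + P) * Y ^ (1 / 335592 : ℝ) := by
    rw [hY, Real.mul_rpow hB.le hX.le, jointConst, ← hBd, mul_assoc]
  rw [e]
  have hYr := Real.rpow_pos_of_pos hY0 (1 / 335592 : ℝ)
  by_cases hY1 : Y ≤ 1
  swap
  · have h1 : 1 ≤ Y ^ (1 / 335592 : ℝ) := Real.one_le_rpow (not_le.1 hY1).le (by norm_num)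
    have h2 : |bdry φ m t - bdry φ m' t'| ≤ P := by
      rw [abs_le]
      constructor <;> linarith [h.bdry_nonneg t, h.bdry_le t, h'.bdry_nonneg t', h'.bdry_le t']
    refine h2.trans ?_
    calc P ≤ (3 * holderConst (10 * P) ^ (1 / 237 : ℝ) + 1 + P) * 1 := by linarith
      _ ≤ _ := by gcongr
  by_cases ht : |t| ≤ 7 * P
  swap
  · have h1 := not_le.1 ht
    have h2 := abs_sub_abs_le_abs_sub t t'
    rw [h.bdry_eq_zero (by linarith), h'.bdry_eq_zero (by linarith), sub_self, abs_zero]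
    positivity
  set η := Y ^ (1 / 1416 : ℝ) with hη
  have hη0 : 0 < η := Real.rpow_pos_of_pos hY0 _
  have hη1 : η ≤ 1 := Real.rpow_le_one hY0.le hY1 (by norm_num)
  have hηp : η ^ 1416 = Y := by
    rw [hη, ← Real.rpow_natCast, ← Real.rpow_mul hY0.le,
      show (1 / 1416 : ℝ) * ((1416 : ℕ) : ℝ) = 1 by norm_num, Real.rpow_one]
  have hYη : Y ≤ η := by
    rw [← hηp]
    exact pow_le_of_le_one hη0.le hη1 (by norm_num)
  have hXY : X ≤ Y := le_mul_of_one_le_left hX.le hB1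
  have hηr : η ^ (1 / 237 : ℝ) = Y ^ (1 / 335592 : ℝ) := by
    rw [hη, ← Real.rpow_mul hY0.le]; norm_num
  have hδ' : (‖a - a'‖ + ‖S - S'‖) * ((10 * P) ^ 4 / η ^ 3) ^ 472 ≤ 1 := by
    rw [div_pow, ← pow_mul, ← pow_mul, ← mul_div_assoc, div_le_one (pow_pos hη0 _)]
    rw [show 3 * 472 = 1416 by norm_num, hηp, show 4 * 472 = 1888 by norm_num, ← hBd, hY, mul_comm]
    exact mul_le_mul_of_nonneg_left (by linarith [abs_nonneg (t - t')]) hB.le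
  refine (h.abs_bdry_sub_le_scale h' ht htt hη0 hη1 hδ' (by linarith)).trans ?_
  rw [Real.mul_rpow hL.le hη0.le, hηr]
  have h5 : η ≤ Y ^ (1 / 335592 : ℝ) := Real.rpow_le_rpow_of_exponent_ge hY0 hY1 (by norm_num)
  nlinarith

/-- Joint Hölder continuity of the boundary values in the data and the spectral parameter. -/
lemma Sys.abs_bdry_sub_le (h : Sys φ P c₁ c₂ a S m v) (h' : Sys φ P c₁ c₂ a' S' m' v')
    {t t' : ℝ} (htt : |t - t'| ≤ 1) :
    |bdry φ m t - bdry φ m' t'| ≤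
      jointConst P * (‖a - a'‖ + ‖S - S'‖ + |t - t'|) ^ (1 / 335592 : ℝ) := by
  set X₀ := ‖a - a'‖ + ‖S - S'‖ + |t - t'| with hX₀
  have hX₀n : 0 ≤ X₀ := by positivity
  have hc : Filter.Tendsto (fun X : ℝ => jointConst P * X ^ (1 / 335592 : ℝ))
      (nhdsWithin X₀ (Set.Ioi X₀)) (nhds (jointConst P * X₀ ^ (1 / 335592 : ℝ))) :=
    (((Real.continuous_rpow_const (by norm_num : (0 : ℝ) ≤ 1 / 335592)).tendsto X₀).const_mul
      _).mono_left nhdsWithin_le_nhds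
  refine ge_of_tendsto hc ?_
  filter_upwards [self_mem_nhdsWithin] with X hX
  exact h.abs_bdry_sub_le_of_pos h' htt (hX₀n.trans_lt hX) (le_of_lt hX)

/-- The base constant controlling all model parameters. -/
def baseConst (c₁ c₂ c₃ : ℝ) : ℝ := 3 + c₁⁻¹ + c₂ + c₃

lemma sys_of {c₃ : ℝ} (h1 : 0 < c₁) (h12 : c₁ ≤ c₂) (h3 : 0 < c₃) (ha : IsSelfAdjoint a)
    (hn : ‖a‖ ≤ c₃) (hS : PosPreserving S) (hf : IsFlat φ S c₁ c₂) (hm : IsDysonSolution a S m)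
    (hv : v.val Set.univ = 1) (hr : StieltjesRep φ v m) :
    Sys φ (baseConst c₁ c₂ c₃) c₁ c₂ a S m v := by
  have h2 : 0 < c₂ := h1.trans_le h12
  have h1' : 0 < c₁⁻¹ := inv_pos.2 h1
  constructor <;> first | assumption | (unfold baseConst; linarith)

lemma sys_of_goodData {c₃ : ℝ} {f : ℝ → ℝ} (h1 : 0 < c₁) (h12 : c₁ ≤ c₂) (h3 : 0 < c₃)
    (h : GoodData φ c₁ c₂ c₃ a S m v f) :
    Sys φ (baseConst c₁ c₂ c₃) c₁ c₂ a S m v ∧ ∀ t, f t = bdry φ m t / Real.pi := by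
  obtain ⟨ha, hn, hS, -, hf, hm, hv, hr, hc, h0, hd⟩ := h
  have hs := sys_of h1 h12 h3 ha hn hS hf hm hv hr
  exact ⟨hs, fun t => hs.density_eq hc h0 hd t⟩

lemma Sys.hasCompactSupport_bdry (h : Sys φ P c₁ c₂ a S m v) :
    HasCompactSupport fun t => bdry φ m t / Real.pi := by
  refine HasCompactSupport.intro (isCompact_Icc (a := -(4 * P)) (b := 4 * P)) fun t ht => ?_
  rw [h.bdry_eq_zero, zero_div]
  by_contra! hlt
  exact ht (abs_le.1 hlt.le)

lemma Sys.abs_bdry_sub_bdry_le (h : Sys φ P c₁ c₂ a S m v) (t t' : ℝ) :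
    |bdry φ m t - bdry φ m t'| ≤ (jointConst P + P) * |t - t'| ^ (1 / 335592 : ℝ) := by
  have hP := h.P_pos
  have hJ := jointConst_pos hP
  by_cases htt : |t - t'| ≤ 1
  · have := h.abs_bdry_sub_le h htt
    simp only [sub_self, norm_zero, zero_add] at this
    refine this.trans ?_
    gcongr
    linarith
  · have h1 : 1 ≤ |t - t'| ^ (1 / 335592 : ℝ) := Real.one_le_rpow (not_le.1 htt).le (by norm_num)
    have h2 : |bdry φ m t - bdry φ m t'| ≤ P := by
      rw [abs_le]
      constructor <;> linarith [h.bdry_nonneg t, h.bdry_le t, h.bdry_nonneg t', h.bdry_le t']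
    nlinarith

end Holder

section Implicit

/-- The Dyson equation on the real line, as a map of data and solution. -/
def dysonMap (u : (A × (A →L[ℂ] A) × ℝ) × A) : A :=
  u.2 * (u.1.2.2 • (1 : A) - u.1.1 + u.1.2.1 u.2) + 1

open scoped ContDiff in
lemma contDiff_dysonMap : ContDiff ℝ ω (dysonMap : (A × (A →L[ℂ] A) × ℝ) × A → A) := by
  have h1 : ContDiff ℝ ω fun u : (A × (A →L[ℂ] A) × ℝ) × A =>
      (ContinuousLinearMap.restrictScalarsL ℂ A A ℝ ℝ) u.1.2.1 u.2 := by
    refine ContDiff.clm_apply ?_ contDiff_snd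
    exact (ContinuousLinearMap.contDiff _).comp (by fun_prop)
  have h2 : ContDiff ℝ ω fun u : (A × (A →L[ℂ] A) × ℝ) × A =>
      u.1.2.2 • (1 : A) - u.1.1 := by fun_prop
  exact (contDiff_snd.mul (h2.add h1)).add contDiff_const

lemma isInvertible_fderiv_dysonMap {a : A} {S : A →L[ℂ] A} {t : ℝ} {x : A}
    (hx : x * (t • (1 : A) - a + S x) = -1) (hx' : (t • (1 : A) - a + S x) * x = -1)
    (hT : IsUnit (1 - sandwich S x)) :
    (fderiv ℝ dysonMap ((a, S, t), x) ∘L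
      .inr ℝ (A × (A →L[ℂ] A) × ℝ) A).IsInvertible := by
  set w := t • (1 : A) - a + S x with hw
  have hS : HasFDerivAt (fun y : A => S y) (S.restrictScalars ℝ) x :=
    (S.restrictScalars ℝ).hasFDerivAt
  have h1 : HasFDerivAt (fun y : A => dysonMap ((a, S, t), y))
      (x • (S.restrictScalars ℝ) + MulOpposite.op w • ContinuousLinearMap.id ℝ A) x :=
    ((hasFDerivAt_id x).mul' (hS.const_add (t • (1 : A) - a))).add_const 1
  have h2 : HasFDerivAt (fun y : A => dysonMap ((a, S, t), y))
      (fderiv ℝ dysonMap ((a, S, t), x) ∘L .inr ℝ (A × (A →L[ℂ] A) × ℝ) A) x :=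
    ((contDiff_dysonMap.contDiffAt.differentiableAt (by simp)).hasFDerivAt (x := ((a, S, t), x))).comp
      x (hasFDerivAt_prodMk_right (a, S, t) x)
  rw [h2.unique h1]
  obtain ⟨T, hT⟩ := hT
  have e1 : ∀ y, (T⁻¹ : (A →L[ℂ] A)ˣ).val (y - x * S y * x) = y := fun y => by
    have : y - x * S y * x = T.val y := by rw [hT]; simp [sandwich_apply]
    rw [this, ← mul_apply_eq_comp, T.inv_mul]; rfl
  have e2 : ∀ y, (T⁻¹ : (A →L[ℂ] A)ˣ).val y - x * S ((T⁻¹ : (A →L[ℂ] A)ˣ).val y) * x = y :=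
    fun y => by
    have : ∀ y, y - x * S y * x = T.val y := fun y => by rw [hT]; simp [sandwich_apply]
    rw [this, ← mul_apply_eq_comp, T.mul_inv]; rfl
  refine ContinuousLinearMap.IsInvertible.of_inverse
    (g := (T⁻¹ : (A →L[ℂ] A)ˣ).val.restrictScalars ℝ ∘L
      (MulOpposite.op (-x) • ContinuousLinearMap.id ℝ A)) ?_ ?_
  · ext y
    have h3 := e2 (-(y * x))
    simp only [ContinuousLinearMap.comp_apply, add_apply,
      smul_apply, ContinuousLinearMap.coe_restrictScalars',
      ContinuousLinearMap.id_apply, op_smul_eq_mul, smul_eq_mul, mul_neg]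
    set b := (T⁻¹ : (A →L[ℂ] A)ˣ).val (-(y * x))
    have h4 : x * S b + b * w = (b - x * S b * x) * w := by
      rw [sub_mul, mul_assoc _ x w, hx]; simp only [mul_neg, mul_one]; abel
    rw [h4, h3, neg_mul, mul_assoc, hx]; simp
  · ext y
    simp only [ContinuousLinearMap.comp_apply, add_apply,
      smul_apply, ContinuousLinearMap.coe_restrictScalars',
      ContinuousLinearMap.id_apply, op_smul_eq_mul, smul_eq_mul, mul_neg]
    have h4 : -((x * S y + y * w) * x) = y - x * S y * x := by
      rw [add_mul, mul_assoc y, hx']; simp only [mul_neg, mul_one]; abel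
    rw [h4, e1]

lemma exists_analyticAt_of_dysonMap_eq_zero (φ : TracialState A) {a : A} {S : A →L[ℂ] A} {t : ℝ}
    {x : A} (hx : x * (t • (1 : A) - a + S x) = -1) (hx' : (t • (1 : A) - a + S x) * x = -1)
    (hT : IsUnit (1 - sandwich S x)) :
    ∃ g : A × (A →L[ℂ] A) × ℝ → ℝ, AnalyticAt ℝ g (a, S, t) ∧
      ∀ᶠ u in nhds ((a, S, t), x), dysonMap u = 0 → g u.1 = (φ.tr u.2).im / Real.pi := by
  have hI := isInvertible_fderiv_dysonMap hx hx' hT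
  have hc := (contDiff_dysonMap (A := A)).contDiffAt (x := ((a, S, t), x))
  have h0 : dysonMap ((a, S, t), x) = 0 := by
    show x * (t • (1 : A) - a + S x) + 1 = 0
    rw [hx, neg_add_cancel]
  let trL : A →L[ℝ] ℝ :=
    Complex.imCLM ∘L (ContinuousLinearMap.restrictScalars ℝ ⟨φ.tr, φ.cont⟩)
  refine ⟨fun u => trL (hc.implicitFunction (by simp) hI u) / Real.pi, ?_, ?_⟩
  · have h1 := hc.contDiffAt_implicitFunction (by simp) hI
    exact ((trL.contDiff.contDiffAt.comp _ h1).div_const _).analyticAt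
  · filter_upwards [hc.eventually_apply_eq_iff_implicitFunction (by simp) hI] with u hu h
    rw [h0] at hu
    simp only [hu.1 h]
    rfl

end Implicit

section Boundary

variable {φ : TracialState A} {P c₁ c₂ : ℝ} {a : A} {S : A →L[ℂ] A} {m : ℂ → A}
  {v : OpMeasure A φ} {a' : A} {S' : A →L[ℂ] A} {m' : ℂ → A} {v' : OpMeasure A φ}

/-- The part of a disc around a real point in the upper half-plane. -/
def halfDisc (t ρ : ℝ) : Set ℂ := {z | 0 < z.im ∧ ‖z - t‖ < ρ}

lemma convex_halfDisc (t ρ : ℝ) : Convex ℝ (halfDisc t ρ) := by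
  have h1 : Convex ℝ {z : ℂ | 0 < z.im} := convex_halfSpace_im_gt 0
  have h2 : Convex ℝ (Metric.ball (t : ℂ) ρ) := convex_ball _ ρ
  have : halfDisc t ρ = {z : ℂ | 0 < z.im} ∩ Metric.ball (t : ℂ) ρ := by
    ext z; simp [halfDisc, dist_eq_norm]
  rw [this]; exact h1.inter h2

lemma halfDisc_subset_halfBall {t ρ Q : ℝ} (h : |t| + ρ ≤ Q) : halfDisc t ρ ⊆ halfBall Q := by
  rintro z ⟨hz, hd⟩
  refine ⟨hz, ?_⟩
  have h1 := norm_add_le (z - t) (t : ℂ)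
  rw [sub_add_cancel, Complex.norm_real, Real.norm_eq_abs] at h1
  linarith

lemma eventually_mk_mem_halfDisc {t t' ρ : ℝ} (ht : |t' - t| < ρ) :
    ∀ᶠ η in nhdsWithin (0 : ℝ) (Set.Ioi 0), (⟨t', η⟩ : ℂ) ∈ halfDisc t ρ := by
  have h1 : ∀ᶠ η in nhdsWithin (0 : ℝ) (Set.Ioi 0), ‖(⟨t', η⟩ : ℂ) - t‖ < ρ :=
    ((tendsto_mk t').sub_const (t : ℂ)).norm.eventually
      (gt_mem_nhds (by rwa [← Complex.ofReal_sub, Complex.norm_real]))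
  filter_upwards [h1, self_mem_nhdsWithin] with η h1 h2
  exact ⟨h2, h1⟩

lemma tendsto_dysonW {x : A} {t : ℝ} (a : A) (S : A →L[ℂ] A)
    (hx : Filter.Tendsto (fun η : ℝ => m ⟨t, η⟩) (nhdsWithin 0 (Set.Ioi 0)) (nhds x)) :
    Filter.Tendsto (fun η : ℝ => dysonW a S ⟨t, η⟩ (m ⟨t, η⟩)) (nhdsWithin 0 (Set.Ioi 0))
      (nhds (t • (1 : A) - a + S x)) := by
  have := (((tendsto_mk t).smul_const (1 : A)).sub_const a).add
    ((S.continuous.tendsto x).comp hx)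
  rwa [Complex.coe_smul] at this

lemma isUnit_of_tendsto {E : Type*} [NormedAddCommGroup E] [NormedSpace ℂ E] [CompleteSpace E]
    {l : Filter ℝ} [l.NeBot] {T : ℝ → E →L[ℂ] E} {T₀ : E →L[ℂ] E} {K : ℝ}
    (hT : Filter.Tendsto T l (nhds T₀)) (hK : 0 < K)
    (hu : ∀ᶠ s in l, IsUnit (T s) ∧ ∀ x, ‖x‖ ≤ K * ‖T s x‖) : IsUnit T₀ := by
  have h1 : ∀ᶠ s in l, ‖T s - T₀‖ < K⁻¹ :=
    (tendsto_iff_norm_sub_tendsto_zero.1 hT).eventually (gt_mem_nhds (inv_pos.2 hK))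
  obtain ⟨s, ⟨⟨U, hU⟩, hb⟩, hs⟩ := (hu.and h1).exists
  rcases subsingleton_or_nontrivial (E →L[ℂ] E) with hE | hE
  · exact isUnit_of_subsingleton T₀
  have h2 : ‖(U⁻¹ : (E →L[ℂ] E)ˣ).val‖ ≤ K := by
    refine ContinuousLinearMap.opNorm_le_bound _ hK.le fun x => ?_
    refine (hb _).trans_eq ?_
    rw [← hU, ← mul_apply_eq_comp, U.mul_inv]; rfl
  have h3 : 0 < ‖(U⁻¹ : (E →L[ℂ] E)ˣ).val‖ := norm_pos_iff.2 U⁻¹.ne_zero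
  refine ⟨U.ofNearby T₀ ?_, rfl⟩
  rw [hU, norm_sub_rev]
  exact hs.trans_le (inv_anti₀ h3 h2)

lemma Sys.exists_boundary_value (h : Sys φ P c₁ c₂ a S m v) {t ρ p : ℝ}
    (hρ : halfDisc t ρ ⊆ halfBall P) (hp : P ≤ p)
    (hr : ∀ z ∈ halfDisc t ρ, p⁻¹ ≤ (φ.tr (m z)).im) {t' : ℝ} (ht : |t' - t| < ρ) :
    ∃ x : A, (x * (t' • (1 : A) - a + S x) = -1 ∧ (t' • (1 : A) - a + S x) * x = -1) ∧
      IsUnit (1 - sandwich S x) ∧ (φ.tr x).im = bdry φ m t' ∧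
      ∀ z ∈ halfDisc t ρ, ‖m z - x‖ ≤ p ^ 236 * ‖z - t'‖ := by
  have hP := h.P_pos
  have hp0 : 0 < p := hP.trans_le hp
  have hev := eventually_mk_mem_halfDisc ht
  have hLip := fun {z z' : ℂ} (hz : z ∈ halfDisc t ρ) (hz' : z' ∈ halfDisc t ρ) =>
    h.norm_sub_le_of_le (convex_halfDisc t ρ) hρ hp hr hz hz'
  obtain ⟨x, hx⟩ : ∃ x, Filter.Tendsto (fun η : ℝ => m ⟨t', η⟩)
      (nhdsWithin 0 (Set.Ioi 0)) (nhds x) := by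
    rw [← cauchy_map_iff_exists_tendsto, Metric.cauchy_iff]
    refine ⟨inferInstance, fun ε hε => ?_⟩
    have h2 : Set.Ioo 0 (ε / p ^ 236) ∈ nhdsWithin (0 : ℝ) (Set.Ioi 0) :=
      Ioo_mem_nhdsGT (by positivity)
    refine ⟨_, Filter.image_mem_map (Filter.inter_mem hev h2), ?_⟩
    rintro _ ⟨η, ⟨hη, hη1⟩, rfl⟩ _ ⟨η', ⟨hη', hη1'⟩, rfl⟩
    rw [dist_eq_norm]
    refine (hLip hη' hη).trans_lt ?_
    rw [mul_comm, ← lt_div_iff₀ (by positivity)]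
    have e : (⟨t', η⟩ : ℂ) - ⟨t', η'⟩ = ⟨0, η - η'⟩ := by apply Complex.ext <;> simp
    rw [e]
    refine (norm_mk_le _ _).trans_lt ?_
    rw [abs_zero, zero_add, abs_lt]
    constructor <;> linarith [hη1.1, hη1.2, hη1'.1, hη1'.2]
  have hw := tendsto_dysonW a S hx
  refine ⟨x, ⟨?_, ?_⟩, ?_, ?_, fun z hz => ?_⟩
  · refine tendsto_nhds_unique (hx.mul hw) (tendsto_const_nhds.congr' ?_)
    filter_upwards [self_mem_nhdsWithin] with η hη
    exact (h.mul_w (z := ⟨t', η⟩) hη).symm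
  · refine tendsto_nhds_unique (hw.mul hx) (tendsto_const_nhds.congr' ?_)
    filter_upwards [self_mem_nhdsWithin] with η hη
    exact (h.w_mul (z := ⟨t', η⟩) hη).symm
  · have hs : Continuous fun y : A => 1 - sandwich S y := by
      unfold sandwich
      refine continuous_const.sub (Continuous.clm_comp ?_ continuous_const)
      have : (fun y : A => ContinuousLinearMap.mulLeftRight ℂ A y y) = fun y =>
          (ContinuousLinearMap.mulLeftRight ℂ A y) y := rfl
      exact (ContinuousLinearMap.mulLeftRight ℂ A).continuous.clm_apply continuous_id
    refine isUnit_of_tendsto (K := (p ^ 10) ^ 23) ((hs.tendsto x).comp hx) (by positivity) ?_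
    filter_upwards [hev] with η hη
    have hc := h.controlled (hρ hη).1 (hρ hη).2 hp (hr _ hη)
    refine ⟨hc.isUnit_one_sub_sandwich, fun y => ?_⟩
    simpa using hc.norm_le y zero_le_one le_rfl
  · refine tendsto_nhds_unique ?_ (h.tendsto_bdry t')
    exact ((Complex.continuous_im.comp φ.cont).tendsto x).comp hx
  · refine le_of_tendsto_of_tendsto (tendsto_const_nhds.sub hx).norm
      ((tendsto_const_nhds.sub (tendsto_mk t')).norm.const_mul (p ^ 236)) ?_
    filter_upwards [hev] with η hη
    exact hLip hη hz

lemma Sys.exists_lower_bound (h : Sys φ P c₁ c₂ a S m v) {t : ℝ} (ht : 0 < bdry φ m t) :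
    ∃ p ρ δ : ℝ, 10 * P ≤ p ∧ 0 < ρ ∧ ρ ≤ 1 ∧ 0 < δ ∧
      ∀ (a' : A) (S' : A →L[ℂ] A) (m' : ℂ → A) (v' : OpMeasure A φ),
        Sys φ P c₁ c₂ a' S' m' v' → ‖a - a'‖ + ‖S - S'‖ < δ →
        ∀ z ∈ halfDisc t ρ, p⁻¹ ≤ (φ.tr (m' z)).im := by
  have hP := h.P_pos
  have hP3 := h.three_le
  have htP : |t| < 4 * P := by
    by_contra! hlt
    exact ht.ne' (h.bdry_eq_zero hlt)
  have hL := holderConst_pos (P := 10 * P) (by positivity)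
  have hJ := jointConst_pos hP
  set r := bdry φ m t with hr
  have hc : Filter.Tendsto (fun X : ℝ => jointConst P * X ^ (1 / 335592 : ℝ))
      (nhds 0) (nhds 0) := by
    have := ((Real.continuous_rpow_const
      (by norm_num : (0 : ℝ) ≤ 1 / 335592)).tendsto 0).const_mul (jointConst P)
    rwa [Real.zero_rpow (by norm_num), mul_zero] at this
  obtain ⟨δ, hδ, hδr⟩ := Metric.eventually_nhds_iff.1
    (hc.eventually (gt_mem_nhds (show 0 < r / 4 by positivity)))
  refine ⟨max (10 * P) (2 / r), min 1 ((r / 4) ^ 237 / holderConst (10 * P)), δ, le_max_left _ _,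
    lt_min one_pos (div_pos (pow_pos (by positivity) _) hL), min_le_left _ _, hδ, ?_⟩
  intro a' S' m' v' h' hδ' z hz
  have hQ' := h'.mono (Q := 10 * P) (by linarith)
  have h1 : |r - bdry φ m' t| < r / 4 := by
    refine (h.abs_bdry_sub_le h' (t' := t) (by simp)).trans_lt (hδr ?_)
    rw [sub_self, abs_zero, add_zero, Real.dist_eq, sub_zero, abs_of_nonneg (by positivity)]
    exact hδ'
  have hzB : z ∈ halfBall (10 * P) := halfDisc_subset_halfBall (by
    have := min_le_left 1 ((r / 4) ^ 237 / holderConst (10 * P)); linarith) hz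
  have h2 : |(φ.tr (m' z)).im - bdry φ m' t| ≤ r / 4 := by
    refine le_of_lt (lt_of_pow_lt_pow_left₀ 237 (by positivity)
      ((hQ'.abs_tr_sub_bdry_pow_le hzB (t := t) (by linarith)).trans_lt ?_))
    rw [mul_comm, ← lt_div_iff₀ hL]
    exact hz.2.trans_le (min_le_right _ _)
  have h3 : (max (10 * P) (2 / r))⁻¹ ≤ (2 / r)⁻¹ := inv_anti₀ (by positivity) (le_max_right _ _)
  rw [inv_div] at h3
  rw [abs_lt] at h1
  rw [abs_le] at h2
  linarith [h1.1, h1.2, h2.1]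

/-- At a point of positive density the solution extends to the real line, with an invertible
stability operator, and the extension is continuous under perturbations of the data. -/
lemma Sys.exists_boundary_value_near (h : Sys φ P c₁ c₂ a S m v) {t : ℝ}
    (ht : 0 < bdry φ m t) :
    ∃ x : A, (x * (t • (1 : A) - a + S x) = -1 ∧ (t • (1 : A) - a + S x) * x = -1) ∧
      IsUnit (1 - sandwich S x) ∧
      ∀ ε : ℝ, 0 < ε → ∃ δ : ℝ, 0 < δ ∧
        ∀ (a' : A) (S' : A →L[ℂ] A) (m' : ℂ → A) (v' : OpMeasure A φ),
          Sys φ P c₁ c₂ a' S' m' v' → ∀ t' : ℝ,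
          ‖a' - a‖ < δ → ‖S' - S‖ < δ → |t' - t| < δ →
          ∃ x' : A, x' * (t' • (1 : A) - a' + S' x') = -1 ∧ (φ.tr x').im = bdry φ m' t' ∧
            ‖x' - x‖ < ε := by
  have hP := h.P_pos
  have hP3 := h.three_le
  have htP : |t| < 4 * P := by
    by_contra! hlt
    exact ht.ne' (h.bdry_eq_zero hlt)
  obtain ⟨p, ρ, δ₀, hp, hρ, hρ1, hδ₀, hlow⟩ := h.exists_lower_bound ht
  have hp0 : 0 < p := by linarith
  have hsub : halfDisc t ρ ⊆ halfBall (10 * P) := halfDisc_subset_halfBall (by linarith)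
  obtain ⟨x, hx, hT, -, hxL⟩ := (h.mono (Q := 10 * P) (by linarith)).exists_boundary_value
    hsub hp (hlow a S m v h (by simpa using hδ₀)) (t' := t) (by simpa using hρ)
  refine ⟨x, hx, hT, fun ε hε => ?_⟩
  set Λ := p ^ 236 with hΛ
  have hΛ0 : 0 < Λ := by positivity
  set η := min (ρ / 2) (ε / (2 * (3 * Λ + 1))) with hη
  have hη0 : 0 < η := by positivity
  have hηρ : η ≤ ρ / 2 := min_le_left _ _
  have hηε : (3 * Λ + 1) * η < ε := by
    have : η * (2 * (3 * Λ + 1)) ≤ ε := by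
      rw [← le_div_iff₀ (by positivity)]; exact min_le_right _ _
    nlinarith
  set K := ((10 * P) ^ 4 / η ^ 3) ^ 472 with hK
  have hK0 : 0 < K := by positivity
  refine ⟨min (min η (δ₀ / 2)) (1 / (2 * K)), by positivity, ?_⟩
  intro a' S' m' v' h' t' ha hS htt
  rw [norm_sub_rev] at ha hS
  rw [lt_min_iff, lt_min_iff] at ha hS htt
  obtain ⟨x', hx', -, hb', hxL'⟩ := (h'.mono (Q := 10 * P) (by linarith)).exists_boundary_value
    hsub hp (hlow a' S' m' v' h' (by linarith)) (t' := t') (by linarith)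
  refine ⟨x', hx'.1, hb', ?_⟩
  have hη1 : ‖(⟨t, η⟩ : ℂ) - t‖ ≤ η := by
    have : (⟨t, η⟩ : ℂ) - t = ⟨0, η⟩ := by apply Complex.ext <;> simp
    rw [this]
    exact (norm_mk_le _ _).trans (by rw [abs_zero, zero_add, abs_of_pos hη0])
  have hη2 : ‖(⟨t, η⟩ : ℂ) - t'‖ ≤ 2 * η := by
    have : (⟨t, η⟩ : ℂ) - t' = ⟨t - t', η⟩ := by apply Complex.ext <;> simp
    rw [this]
    refine (norm_mk_le _ _).trans ?_
    rw [abs_of_pos hη0, abs_sub_comm]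
    linarith [htt.1.1]
  have hmem : (⟨t, η⟩ : ℂ) ∈ halfDisc t ρ := ⟨hη0, by linarith⟩
  have h1 := hxL _ hmem
  have h2 := hxL' _ hmem
  have h3 := h.norm_sub_le_of_data h' (t := t) (by linarith) hη0 (by linarith) (by
    rw [← hK, ← le_div_iff₀ hK0]
    have : 1 / K = 1 / (2 * K) + 1 / (2 * K) := by field_simp; norm_num
    linarith [ha.2, hS.2])
  have h4 : x' - x = (m ⟨t, η⟩ - x) + (m' ⟨t, η⟩ - m ⟨t, η⟩) - (m' ⟨t, η⟩ - x') := by abel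
  rw [h4]
  calc _ ≤ ‖m ⟨t, η⟩ - x‖ + ‖m' ⟨t, η⟩ - m ⟨t, η⟩‖ + ‖m' ⟨t, η⟩ - x'‖ :=
        (_root_.norm_sub_le _ _).trans (add_le_add (norm_add_le _ _) le_rfl)
    _ ≤ Λ * η + η + Λ * (2 * η) := by
        refine add_le_add (add_le_add (h1.trans ?_) h3) (h2.trans ?_) <;> gcongr
    _ = (3 * Λ + 1) * η := by ring
    _ < ε := hηε

/-- Analytic dependence of the boundary values on the data at points of positive density. -/
lemma Sys.exists_analyticAt (h : Sys φ P c₁ c₂ a S m v) {t : ℝ} (ht : 0 < bdry φ m t) :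
    ∃ g : A × (A →L[ℂ] A) × ℝ → ℝ, AnalyticAt ℝ g (a, S, t) ∧
      ∃ δ : ℝ, 0 < δ ∧
        ∀ (a' : A) (S' : A →L[ℂ] A) (m' : ℂ → A) (v' : OpMeasure A φ),
          Sys φ P c₁ c₂ a' S' m' v' → ∀ t' : ℝ,
          ‖a' - a‖ < δ → ‖S' - S‖ < δ → |t' - t| < δ →
          bdry φ m' t' / Real.pi = g (a', S', t') := by
  obtain ⟨x, hx, hT, hnear⟩ := h.exists_boundary_value_near ht
  obtain ⟨g, hg, hev⟩ := exists_analyticAt_of_dysonMap_eq_zero φ hx.1 hx.2 hT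
  obtain ⟨ε, hε, hball⟩ := Metric.eventually_nhds_iff.1 hev
  obtain ⟨δ, hδ, hδ'⟩ := hnear ε hε
  refine ⟨g, hg, min δ ε, lt_min hδ hε, ?_⟩
  intro a' S' m' v' h' t' ha hS htt
  rw [lt_min_iff] at ha hS htt
  obtain ⟨x', hx', hb, hd⟩ := hδ' a' S' m' v' h' t' ha.1 hS.1 htt.1
  have h1 := hball (y := ((a', S', t'), x')) (by
    rw [← dist_eq_norm] at ha hS hd
    rw [← Real.norm_eq_abs, ← dist_eq_norm] at htt
    simp only [Prod.dist_eq, max_lt_iff]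
    exact ⟨⟨ha.2, hS.2, htt.2⟩, hd⟩) (by
    show x' * (t' • (1 : A) - a' + S' x') + 1 = 0
    rw [hx', neg_add_cancel])
  rw [h1, hb]

end Boundary

end Dyson

open Dyson in
/-- **Proposition (regularity of the density of states).** For flat data pairs the
self-consistent density of states has a uniformly Hölder continuous, compactly supported
density with respect to Lebesgue measure; there is a universal Hölder exponent `c > 0`
such that `(a, S, τ) ↦ ρ_{a,S}(τ)` is locally `c`-Hölder continuous, and it is
real-analytic in a neighbourhood of every point where it is positive. -/
theorem regularity_of_density_of_states
    {A : Type*} [CStarAlgebra A] [PartialOrder A] [StarOrderedRing A]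
    (φ : TracialState A) :
    ∃ c : ℝ, 0 < c ∧ c ≤ 1 ∧
      ∀ c₁ c₂ c₃ : ℝ, 0 < c₁ → c₁ ≤ c₂ → 0 < c₃ →
        ∃ C ε : ℝ, 0 < C ∧ 0 < ε ∧
          -- existence of a uniformly `c`-Hölder continuous compactly supported density
          (∀ (a : A) (S : A →L[ℂ] A) (m : ℂ → A) (v : OpMeasure A φ),
            IsSelfAdjoint a → ‖a‖ ≤ c₃ → PosPreserving S → SymmOp φ S →
            IsFlat φ S c₁ c₂ → IsDysonSolution a S m →
            v.val Set.univ = 1 → StieltjesRep φ v m →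
            ∃ f : ℝ → ℝ, GoodData φ c₁ c₂ c₃ a S m v f ∧ HasCompactSupport f ∧
              ∀ t₁ t₂ : ℝ, |f t₁ - f t₂| ≤ C * |t₁ - t₂| ^ c) ∧
          -- joint local Hölder continuity in the data `(a, S, τ)`
          (∀ (a a' : A) (S S' : A →L[ℂ] A) (m m' : ℂ → A)
              (v v' : OpMeasure A φ) (f f' : ℝ → ℝ),
            GoodData φ c₁ c₂ c₃ a S m v f → GoodData φ c₁ c₂ c₃ a' S' m' v' f' →
            ∀ t t' : ℝ, ‖a - a'‖ ≤ ε → ‖S - S'‖ ≤ ε → |t - t'| ≤ ε →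
              |f t - f' t'| ≤ C * (‖a - a'‖ + ‖S - S'‖ + |t - t'|) ^ c) ∧
          -- joint real-analyticity where the density is positive
          (∀ (a : A) (S : A →L[ℂ] A) (m : ℂ → A) (v : OpMeasure A φ) (f : ℝ → ℝ),
            GoodData φ c₁ c₂ c₃ a S m v f →
            ∀ t : ℝ, 0 < f t →
              ∃ g : A × (A →L[ℂ] A) × ℝ → ℝ,
                AnalyticAt ℝ g (a, S, t) ∧
                ∃ δ : ℝ, 0 < δ ∧
                  ∀ (a' : A) (S' : A →L[ℂ] A) (m' : ℂ → A) (v' : OpMeasure A φ)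
                      (f' : ℝ → ℝ),
                    GoodData φ c₁ c₂ c₃ a' S' m' v' f' →
                    ∀ t' : ℝ, ‖a' - a‖ < δ → ‖S' - S‖ < δ → |t' - t| < δ →
                      f' t' = g (a', S', t')) := by
  refine ⟨1 / 335592, by norm_num, by norm_num, fun c₁ c₂ c₃ h1 h12 h3 => ?_⟩
  have hP : 0 < baseConst c₁ c₂ c₃ := by
    have := inv_pos.2 h1
    unfold baseConst
    linarith
  have hJ := jointConst_pos hP
  set P := baseConst c₁ c₂ c₃
  have hpi : 1 ≤ Real.pi := by linarith [Real.pi_gt_three]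
  have hdiv : ∀ x y K : ℝ, |x - y| ≤ K → |x / Real.pi - y / Real.pi| ≤ K := fun x y K h => by
    rw [← sub_div, abs_div, abs_of_pos Real.pi_pos]
    exact (div_le_self (abs_nonneg _) hpi).trans h
  refine ⟨jointConst P + P, 1, by linarith, one_pos, ?_, ?_, ?_⟩
  · intro a S m v ha hn hS hsymm hf hm hv hr
    have hs : Sys φ P c₁ c₂ a S m v := sys_of h1 h12 h3 ha hn hS hf hm hv hr
    exact ⟨fun t => bdry φ m t / Real.pi,
      ⟨ha, hn, hS, hsymm, hf, hm, hv, hr, hs.continuous_bdry.div_const _,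
        fun t => div_nonneg (hs.bdry_nonneg t) Real.pi_pos.le, hs.dos_eq⟩,
      hs.hasCompactSupport_bdry, fun t₁ t₂ => hdiv _ _ _ (hs.abs_bdry_sub_bdry_le t₁ t₂)⟩
  · intro a a' S S' m m' v v' f f' hd hd' t t' _ _ htt
    obtain ⟨hs, hf⟩ := sys_of_goodData h1 h12 h3 hd
    obtain ⟨hs', hf'⟩ := sys_of_goodData h1 h12 h3 hd'
    rw [hf, hf']
    refine hdiv _ _ _ ((hs.abs_bdry_sub_le hs' htt).trans ?_)
    gcongr
    linarith
  · intro a S m v f hd t ht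
    obtain ⟨hs, hf⟩ := sys_of_goodData h1 h12 h3 hd
    rw [hf] at ht
    obtain ⟨g, hg, δ, hδ, hgδ⟩ := hs.exists_analyticAt ((div_pos_iff_of_pos_right Real.pi_pos).1 ht)
    refine ⟨g, hg, δ, hδ, fun a' S' m' v' f' hd' t' ha hS htt => ?_⟩
    obtain ⟨hs', hf'⟩ := sys_of_goodData h1 h12 h3 hd'
    rw [hf', hgδ a' S' m' v' hs' t' ha hS htt]
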